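/- arXiv:1412.8137 — 6 statements merged into one kernel-verified Lean document; each statement's English description precedes it below -/
import Mathlib

section
/- For n ≥ 3, the Randić characteristic polynomial of the cycle graph C_n satisfies RP(C_n, λ) = λ·Λ_{n−1} − (1/2)·Λ_{n−2} − (1/2)^{n−1}, where Λ_1 = λ, Λ_2 = λ² − 1/4, and Λ_k = λ·Λ_{k−1} − (1/4)·Λ_{k−2} for every k ≥ 3. -/
open scoped Classical

/-- The energy of a real matrix: the sum of the absolute values of its eigenvalues
(with multiplicity), when the matrix is Hermitian (= symmetric). -/
noncomputable def matrixEnergy {n : Type*} [Fintype n] (A : Matrix n n ℝ) : ℝ :=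
  if h : A.IsHermitian then ∑ i, |h.eigenvalues i| else 0

/-- The energy of a finite simple graph: the sum of the absolute values of the
eigenvalues of its adjacency matrix. -/
noncomputable def SimpleGraph.energy {V : Type*} [Fintype V] (G : SimpleGraph V) : ℝ :=
  matrixEnergy (G.adjMatrix ℝ)

/-- The Randić matrix of a finite simple graph: `(i,j)`-entry `1/√(dᵢ dⱼ)` if `i ~ j`, else `0`. -/
noncomputable def SimpleGraph.randicMatrix {V : Type*} [Fintype V] (G : SimpleGraph V) :
    Matrix V V ℝ :=
  Matrix.of fun i j =>
    if G.Adj i j then 1 / Real.sqrt ((G.degree i : ℝ) * (G.degree j : ℝ)) else 0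

/-- The Randić energy of a finite simple graph: the sum of the absolute values of the
eigenvalues of its Randić matrix. -/
noncomputable def SimpleGraph.randicEnergy {V : Type*} [Fintype V] (G : SimpleGraph V) : ℝ :=
  matrixEnergy G.randicMatrix

/-- The Randić characteristic polynomial `det (λ I - R(G))`. -/
noncomputable def SimpleGraph.randicCharpoly {V : Type*} [Fintype V] (G : SimpleGraph V) :
    Polynomial ℝ :=
  G.randicMatrix.charpoly

open Polynomial in
/-- The polynomials `Λ_k`: `Λ_1 = λ`, `Λ_2 = λ² - 1/4`, and
`Λ_k = λ·Λ_{k-1} - (1/4)·Λ_{k-2}` for `k ≥ 3`. -/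
noncomputable def Lam : ℕ → Polynomial ℝ
  | 0 => 1
  | 1 => X
  | 2 => X ^ 2 - C (1 / 4 : ℝ)
  | (k + 3) => X * Lam (k + 2) - C (1 / 4 : ℝ) * Lam (k + 1)

open Polynomial in
theorem det_col2 {R : Type*} [CommRing R] {m : ℕ} (A : Matrix (Fin (m + 2)) (Fin (m + 2)) R)
    (h : ∀ i, i ≠ 0 → i ≠ Fin.last _ → A i 0 = 0) :
    A.det = A 0 0 * (A.submatrix Fin.succ Fin.succ).det
      + (-1) ^ (m + 1) * A (Fin.last _) 0 * (A.submatrix Fin.castSucc Fin.succ).det := by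
  rw [Matrix.det_succ_column_zero, Fin.sum_univ_succ, Fin.sum_univ_castSucc,
    Finset.sum_eq_zero]
  · have hl : (Fin.last (m + 1)).succAbove = Fin.castSucc := by
      funext i; simp
    have h0 : (0 : Fin (m + 2)).succAbove = Fin.succ := by
      funext i; simp
    rw [Fin.succ_last, hl, h0]
    simp
  · intro i _
    rw [h]
    · simp
    · exact Fin.succ_ne_zero _
    · intro hh
      have := congrArg Fin.val hh
      have := i.2
      simp at *
      try omega

theorem det_row3 {R : Type*} [CommRing R] {m : ℕ} (A : Matrix (Fin (m + 3)) (Fin (m + 3)) R)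
    (h : ∀ i, i ≠ 0 → i ≠ 1 → i ≠ Fin.last _ → A 0 i = 0) :
    A.det = A 0 0 * (A.submatrix Fin.succ Fin.succ).det
      - A 0 1 * (A.submatrix Fin.succ (Fin.succAbove 1)).det
      + (-1) ^ (m + 2) * A 0 (Fin.last _) * (A.submatrix Fin.succ Fin.castSucc).det := by
  rw [Matrix.det_succ_row_zero, Fin.sum_univ_succ, Fin.sum_univ_succ, Fin.sum_univ_castSucc,
    Finset.sum_eq_zero]
  · have hl : (Fin.last (m + 2)).succAbove = Fin.castSucc := by
      funext i; simp
    have h0 : (0 : Fin (m + 3)).succAbove = Fin.succ := by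
      funext i; simp
    rw [Fin.succ_last, Fin.succ_last, hl, h0]
    simp
    ring
  · intro i _
    rw [h]
    · simp
    · exact Fin.succ_ne_zero _
    · intro hh
      have := congrArg Fin.val hh
      simp at this
    · intro hh
      have := congrArg Fin.val hh
      have := i.2
      simp at *
      try omega

theorem one_succAbove_val {m : ℕ} (i : Fin (m + 2)) :
    ((Fin.succAbove (1 : Fin (m + 3)) i : Fin (m + 3)) : ℕ) = if (i : ℕ) = 0 then 0 else (i : ℕ) + 1 := by
  rcases Fin.eq_zero_or_eq_succ i with rfl | ⟨j, rfl⟩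
  · simp [Fin.succAbove]
  · simp [Fin.succAbove, Fin.lt_def]

/-- Tridiagonal path matrix. -/
def pathMat {R : Type*} [CommRing R] (x c : R) (n : ℕ) : Matrix (Fin n) (Fin n) R :=
  Matrix.of fun i j => if (i : ℕ) = j then x else
    if (i : ℕ) + 1 = j ∨ (j : ℕ) + 1 = i then -c else 0

/-- Cyclic tridiagonal matrix. -/
def cycMat {R : Type*} [CommRing R] (x c : R) (m : ℕ) : Matrix (Fin (m + 3)) (Fin (m + 3)) R :=
  Matrix.of fun i j => if (i : ℕ) = j then x else
    if (i : ℕ) + 1 = j ∨ (j : ℕ) + 1 = i ∨ ((i : ℕ) = 0 ∧ (j : ℕ) = m + 2) ∨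
      ((j : ℕ) = 0 ∧ (i : ℕ) = m + 2) then -c else 0

theorem pathMat_det_rec {R : Type*} [CommRing R] (x c : R) (m : ℕ) :
    (pathMat x c (m + 3)).det
      = x * (pathMat x c (m + 2)).det - c ^ 2 * (pathMat x c (m + 1)).det := by
  rw [det_row3, det_col2 ((pathMat x c (m + 3)).submatrix Fin.succ (Fin.succAbove 1))]
  · have h1 : (pathMat x c (m + 3)).submatrix Fin.succ Fin.succ = pathMat x c (m + 2) := by
      ext i j; simp [pathMat]
    have h2 : ((pathMat x c (m + 3)).submatrix Fin.succ (Fin.succAbove 1)).submatrix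
        Fin.succ Fin.succ = pathMat x c (m + 1) := by
      ext i j; simp [pathMat, one_succAbove_val]
    rw [h1, h2]
    have e0 : pathMat x c (m + 3) 0 0 = x := by simp [pathMat]
    have e1 : pathMat x c (m + 3) 0 1 = -c := by simp [pathMat]
    have e2 : pathMat x c (m + 3) 0 (Fin.last _) = 0 := by simp [pathMat]
    have e3 : (pathMat x c (m + 3)).submatrix Fin.succ (Fin.succAbove 1) 0 0 = -c := by
      simp [pathMat]
    have e4 : (pathMat x c (m + 3)).submatrix Fin.succ (Fin.succAbove 1) (Fin.last _) 0 = 0 := by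
      simp [pathMat]
    rw [e0, e1, e2, e3, e4]
    ring
  · intro i h0 h1
    have : (i : ℕ) ≠ 0 := fun h => h0 (Fin.ext h)
    simp [pathMat, this]
  · intro i h0 h1 h2
    have a0 : (i : ℕ) ≠ 0 := fun h => h0 (Fin.ext h)
    have a1 : (i : ℕ) ≠ 1 := fun h => h1 (Fin.ext (by simp [h]))
    simp [pathMat, a0.symm, a1.symm]

theorem cycMat_det {R : Type*} [CommRing R] (x c : R) (m : ℕ) :
    (cycMat x c m).det
      = x * (pathMat x c (m + 2)).det - 2 * c ^ 2 * (pathMat x c (m + 1)).det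
        - 2 * c ^ (m + 3) := by
  rw [det_row3, det_col2 ((cycMat x c m).submatrix Fin.succ (Fin.succAbove 1)),
    det_col2 ((cycMat x c m).submatrix Fin.succ Fin.castSucc)]
  · have h1 : (cycMat x c m).submatrix Fin.succ Fin.succ = pathMat x c (m + 2) := by
      ext i j; simp [pathMat, cycMat]
    have h2 : ((cycMat x c m).submatrix Fin.succ (Fin.succAbove 1)).submatrix
        Fin.succ Fin.succ = pathMat x c (m + 1) := by
      ext i j; simp [pathMat, cycMat, one_succAbove_val]
    have h3 : ((cycMat x c m).submatrix Fin.succ Fin.castSucc).submatrix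
        Fin.castSucc Fin.succ = pathMat x c (m + 1) := by
      ext i j; simp [pathMat, cycMat]
    have h4 : (((cycMat x c m).submatrix Fin.succ (Fin.succAbove 1)).submatrix
        Fin.castSucc Fin.succ).det = (-c) ^ (m + 1) := by
      rw [Matrix.det_of_isLowerTriangular]
      · simp [cycMat, one_succAbove_val]
      · intro i j hij
        have hij : (i : ℕ) < j := hij
        simp only [cycMat, Matrix.submatrix_apply, Matrix.of_apply, one_succAbove_val,
          Fin.val_succ, Fin.val_castSucc]
        rw [if_neg (show ¬ ((j : ℕ) + 1 = 0) by omega)]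
        have := i.2
        have := j.2
        repeat rw [if_neg (by omega)]
    have h5 : (((cycMat x c m).submatrix Fin.succ Fin.castSucc).submatrix
        Fin.succ Fin.succ).det = (-c) ^ (m + 1) := by
      rw [Matrix.det_of_isUpperTriangular]
      · simp [cycMat]
      · intro i j hij
        have hij : (j : ℕ) < i := hij
        simp only [cycMat, Matrix.submatrix_apply, Matrix.of_apply,
          Fin.val_succ, Fin.val_castSucc]
        have := i.2
        have := j.2
        repeat rw [if_neg (by omega)]
    rw [h1, h2, h3, h4, h5]
    have e0 : cycMat x c m 0 0 = x := by simp [cycMat]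
    have e1 : cycMat x c m 0 1 = -c := by simp [cycMat]
    have e2 : cycMat x c m 0 (Fin.last _) = -c := by simp [cycMat]
    have e3 : (cycMat x c m).submatrix Fin.succ (Fin.succAbove 1) 0 0 = -c := by
      simp [cycMat]
    have e4 : (cycMat x c m).submatrix Fin.succ (Fin.succAbove 1) (Fin.last _) 0 = -c := by
      simp [cycMat]
    have e5 : (cycMat x c m).submatrix Fin.succ Fin.castSucc 0 0 = -c := by
      simp [cycMat]
    have e6 : (cycMat x c m).submatrix Fin.succ Fin.castSucc (Fin.last _) 0 = -c := by
      simp [cycMat]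
    rw [e0, e1, e2, e3, e4, e5, e6, neg_pow c]
    have hs : ((-1 : R) ^ m) ^ 2 = 1 := by rw [← pow_mul, mul_comm, pow_mul]; simp
    linear_combination (-2 * c ^ (m + 3) - c ^ 2 * (pathMat x c (m + 1)).det) * hs
  · intro i h0 h1
    have a0 : (i : ℕ) ≠ 0 := fun h => h0 (Fin.ext h)
    have a1 : (i : ℕ) ≠ m + 1 := fun h => h1 (Fin.ext h)
    simp [cycMat, a0, a1]
  · intro i h0 h1
    have a0 : (i : ℕ) ≠ 0 := fun h => h0 (Fin.ext h)
    have a1 : (i : ℕ) ≠ m + 1 := fun h => h1 (Fin.ext h)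
    simp [cycMat, a0, a1]
  · intro i h0 h1 h2
    have a0 : (i : ℕ) ≠ 0 := fun h => h0 (Fin.ext h)
    have a1 : (i : ℕ) ≠ 1 := fun h => h1 (Fin.ext (by simp [h]))
    have a2 : (i : ℕ) ≠ m + 2 := fun h => h2 (Fin.ext h)
    simp [cycMat, a0, a0.symm, a1.symm, a2]

open Polynomial in
theorem pathMat_det_Lam (k : ℕ) :
    (pathMat (X : ℝ[X]) (C (1 / 2 : ℝ)) (k + 1)).det = Lam (k + 1) ∧
    (pathMat (X : ℝ[X]) (C (1 / 2 : ℝ)) (k + 2)).det = Lam (k + 2) := by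
  have hc : (C (1 / 2 : ℝ)) ^ 2 = C (1 / 4 : ℝ) := by
    rw [← C_pow]; norm_num
  induction k with
  | zero =>
    constructor
    · simp [pathMat, Lam]
    · have : Lam (0 + 2) = X ^ 2 - C (1 / 4 : ℝ) := by simp [Lam]
      rw [this, ← hc, Matrix.det_fin_two]
      simp only [pathMat, Matrix.of_apply]
      simp
      ring
  | succ k ih =>
    refine ⟨ih.2, ?_⟩
    rw [pathMat_det_rec, ih.1, ih.2, hc]
    rfl

open Polynomial in
theorem charmatrix_cycle (m : ℕ) :
    (SimpleGraph.cycleGraph (m + 3)).randicMatrix.charmatrix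
      = cycMat (X : ℝ[X]) (C (1 / 2 : ℝ)) m := by
  ext1 i j
  have hdeg : ∀ (v : Fin (m + 3)) [Fintype ((SimpleGraph.cycleGraph (m + 3)).neighborSet v)],
      (SimpleGraph.cycleGraph (m + 3)).degree v = 2 := by
    intro v _
    convert SimpleGraph.cycleGraph_degree_three_le (v := v)
  have hs : Real.sqrt (((2 : ℕ) : ℝ) * ((2 : ℕ) : ℝ)) = 2 := by
    push_cast
    exact Real.sqrt_mul_self (by norm_num)
  by_cases hij : i = j
  · subst hij
    simp [cycMat, Matrix.charmatrix_apply_eq, SimpleGraph.randicMatrix]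
  · have hne : (i : ℕ) ≠ j := fun h => hij (Fin.ext h)
    rw [Matrix.charmatrix_apply_ne _ _ _ hij]
    simp only [SimpleGraph.randicMatrix, Matrix.of_apply, hdeg, hs, cycMat, if_neg hne]
    have hadj : (SimpleGraph.cycleGraph (m + 3)).Adj i j ↔
        ((i : ℕ) + 1 = j ∨ (j : ℕ) + 1 = i ∨ ((i : ℕ) = 0 ∧ (j : ℕ) = m + 2) ∨
          ((j : ℕ) = 0 ∧ (i : ℕ) = m + 2)) := by
      rw [SimpleGraph.cycleGraph_adj']
      have := i.2
      have := j.2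
      rw [Fin.sub_def, Fin.sub_def]
      simp only
      rcases lt_or_gt_of_ne hne with h | h
      · rw [Nat.mod_eq_of_lt (by omega), Nat.mod_eq_sub_mod (by omega),
          Nat.mod_eq_of_lt (by omega)]
        omega
      · rw [Nat.mod_eq_sub_mod (by omega), Nat.mod_eq_of_lt (by omega),
          Nat.mod_eq_of_lt (by omega)]
        omega
    by_cases ha : (SimpleGraph.cycleGraph (m + 3)).Adj i j
    · rw [if_pos ha, if_pos (hadj.1 ha)]
    · rw [if_neg ha, if_neg (fun h => ha (hadj.2 h))]
      simp

open Polynomial in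
theorem randicCharpoly_cycleGraph (n : ℕ) (hn : 3 ≤ n) :
    (SimpleGraph.cycleGraph n).randicCharpoly =
      X * Lam (n - 1) - C (1 / 2 : ℝ) * Lam (n - 2) - C ((1 / 2 : ℝ) ^ (n - 1)) := by
  obtain ⟨m, rfl⟩ : ∃ m, n = m + 3 := ⟨n - 3, by omega⟩
  have hc : 2 * (C (1 / 2 : ℝ)) = 1 := by
    rw [← C_ofNat, ← C_mul]; norm_num
  have h : (SimpleGraph.cycleGraph (m + 3)).randicCharpoly =
      (cycMat (X : ℝ[X]) (C (1 / 2 : ℝ)) m).det := by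
    rw [← charmatrix_cycle]
    unfold SimpleGraph.randicCharpoly Matrix.charpoly
    congr!
  rw [h, cycMat_det, (pathMat_det_Lam m).1, (pathMat_det_Lam m).2]
  have e1 : m + 3 - 1 = m + 2 := by omega
  have e2 : m + 3 - 2 = m + 1 := by omega
  rw [e1, e2, C_pow]
  linear_combination (-(C (1 / 2 : ℝ)) * Lam (m + 1) - (C (1 / 2 : ℝ)) ^ (m + 2)) * hc
end

section
/- The Petersen graph has maximum energy among all 3-regular simple graphs on 10 vertices: for every 3-regular simple graph G on 10 vertices, E(G) ≤ 16. -/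
open scoped Classical

namespace CubicTen
noncomputable section
def sel {α : Type} (b : Bool) (t f : α) : α := @Bool.rec (fun _ => α) f t b
def allL (l : List ℕ) (p : ℕ → Bool) : Bool :=
  @List.rec ℕ (fun _ => Bool) true (fun a _ ih => sel (p a) ih false) l
def filt (l : List ℕ) (p : ℕ → Bool) : List ℕ :=
  @List.rec ℕ (fun _ => List ℕ) [] (fun a _ ih => sel (p a) (a :: ih) ih) l
def sumL (l : List ℕ) (g : ℕ → ℕ) : ℕ :=
  @List.rec ℕ (fun _ => ℕ) 0 (fun a _ ih => Nat.add (g a) ih) l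
def bt (H a b : ℕ) : Bool :=
  Nat.beq (Nat.land (Nat.shiftRight H (Nat.add (Nat.mul 10 a) b)) 1) 1
def ad (H v w : ℕ) : ℕ :=
  Nat.lor (Nat.lor H (Nat.shiftLeft 1 (Nat.add (Nat.mul 10 v) w)))
    (Nat.shiftLeft 1 (Nat.add (Nat.mul 10 w) v))
def idx : List ℕ := [0, 1, 2, 3, 4, 5, 6, 7, 8, 9]
def row (H a : ℕ) : ℕ := Nat.mod (Nat.shiftRight H (Nat.mul 10 a)) 1024
def nb (H a : ℕ) : List ℕ := filt idx (bt H a)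
def table : ℕ := 528294531135665246380978688841659684333571690922734070304423921841576854894809499871457435082512876571715196982309916012231250443114832680057665413450518199444981216828290566107271350748126166944935897472937309478005355750505310695371324294729813144560023411515560847488
def full (H a : ℕ) : Bool := Nat.beq (Nat.land (Nat.shiftRight table (row H a)) 1) 1
def iso (H a : ℕ) : Bool := Nat.beq (row H a) 0
def walk (H : ℕ) (k : ℕ) : ℕ → ℕ :=
  @Nat.rec (fun _ => ℕ → ℕ) (fun a => Nat.pow 1024 a) (fun _ ih a => sumL (nb H a) ih) k
def tr (H k : ℕ) : ℕ :=
  sumL idx fun a => Nat.mod (Nat.div (walk H k a) (Nat.pow 1024 a)) 1024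
def leaf (H : ℕ) : Bool :=
  sel (allL idx (full H))
    (sel (Nat.ble (Nat.add (tr H 6) 810) (Nat.mul 12 (tr H 4))) true
      (Nat.ble (Nat.add (tr H 6) 2616) (Nat.mul 23 (tr H 4)))) false
def blocked (H v m w : ℕ) : Bool :=
  sel (Nat.beq w v) true <| sel (full H w) true <| sel (bt H v w) true <|
    sel (iso H w)
      (sel (allL idx fun u => sel (Nat.ble w u) true (sel (Nat.beq u v) true
        (sel (iso H u) false true))) false true)
      (Nat.ble (Nat.succ w) m)
def search (n : ℕ) : ℕ → ℕ → ℕ → Bool :=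
  @Nat.rec (fun _ => ℕ → ℕ → ℕ → Bool) (fun _ _ _ => false)
    (fun _ ih H v m =>
      sel (full H v) (sel (Nat.beq v 9) (leaf H) (ih H (Nat.succ v) 0))
        (allL idx fun w => sel (blocked H v m w) true
          (ih (ad H v w) v (sel (iso H w) 10 (Nat.succ w))))) n

theorem sel_eq {α : Type} (b : Bool) (t f : α) : sel b t f = if b = true then t else f := by
  cases b <;> rfl

theorem allL_iff (l : List ℕ) (p : ℕ → Bool) : allL l p = true ↔ ∀ a ∈ l, p a = true := by
  induction l with
  | nil => simp [allL]
  | cons a l ih =>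
    have : allL (a :: l) p = sel (p a) (allL l p) false := rfl
    rw [this, sel_eq]
    split_ifs with h <;> simp [h, ih]

theorem filt_eq (l : List ℕ) (p : ℕ → Bool) : filt l p = l.filter p := by
  induction l with
  | nil => rfl
  | cons a l ih =>
    have : filt (a :: l) p = sel (p a) (a :: filt l p) (filt l p) := rfl
    rw [this, sel_eq, ih, List.filter_cons]

theorem sumL_filt (l : List ℕ) (p : ℕ → Bool) (g : ℕ → ℕ) :
    sumL (filt l p) g = (l.map fun a => if p a = true then g a else 0).sum := by
  induction l with
  | nil => rfl
  | cons a l ih =>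
    have : filt (a :: l) p = sel (p a) (a :: filt l p) (filt l p) := rfl
    rw [this, sel_eq, List.map_cons, List.sum_cons, ← ih]
    split_ifs with h
    · rfl
    · simp

theorem sumL_eq (l : List ℕ) (g : ℕ → ℕ) : sumL l g = (l.map g).sum := by
  induction l with
  | nil => rfl
  | cons a l ih => rw [List.map_cons, List.sum_cons, ← ih]; rfl

theorem idx_eq : idx = List.range 10 := by decide

theorem mem_idx (a : ℕ) : a ∈ idx ↔ a < 10 := by rw [idx_eq, List.mem_range]

theorem idx_sum (g : ℕ → ℕ) : (idx.map g).sum = ∑ a ∈ Finset.range 10, g a := by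
  simp [idx, Finset.sum_range_succ]; ring

theorem sumL_idx (g : ℕ → ℕ) : sumL idx g = ∑ a ∈ Finset.range 10, g a := by
  rw [sumL_eq, idx_sum]

theorem bt_eq (H a b : ℕ) : bt H a b = H.testBit (10 * a + b) := by
  have h : bt H a b = Nat.beq ((H >>> (10 * a + b)) &&& 1) 1 := rfl
  rw [h, Nat.testBit, Nat.and_comm]
  have : 1 &&& (H >>> (10 * a + b)) < 2 := by
    rw [Nat.and_comm, Nat.and_one_is_mod]; exact Nat.mod_lt _ (by norm_num)
  generalize 1 &&& (H >>> (10 * a + b)) = x at this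
  interval_cases x <;> rfl

theorem bt_ad (H v w a b : ℕ) (hv : v < 10) (hw : w < 10) (hb : b < 10) :
    bt (ad H v w) a b = true ↔ bt H a b = true ∨ (a = v ∧ b = w) ∨ (a = w ∧ b = v) := by
  have h : ad H v w = (H ||| 1 <<< (10 * v + w)) ||| 1 <<< (10 * w + v) := rfl
  rw [h, bt_eq, bt_eq, Nat.testBit_or, Nat.testBit_or, Nat.one_shiftLeft, Nat.one_shiftLeft,
    Nat.testBit_two_pow, Nat.testBit_two_pow]
  simp only [Bool.or_eq_true, decide_eq_true_eq]
  rw [or_assoc]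
  have e1 : 10 * v + w = 10 * a + b ↔ a = v ∧ b = w := by omega
  have e2 : 10 * w + v = 10 * a + b ↔ a = w ∧ b = v := by omega
  rw [e1, e2]

theorem bt_row (H a b : ℕ) (hb : b < 10) : bt H a b = (row H a).testBit b := by
  have h : row H a = (H >>> (10 * a)) % 2 ^ 10 := rfl
  rw [h, bt_eq, Nat.testBit_mod_two_pow, Nat.testBit_shiftRight]
  simp [hb]

theorem iso_bt (H a b : ℕ) (hb : b < 10) (h : iso H a = true) : bt H a b = false := by
  have h0 : row H a = 0 := Nat.eq_of_beq_eq_true h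
  rw [bt_row H a b hb, h0, Nat.zero_testBit]

theorem table_spec : allL (List.range 1024) (fun x =>
    Nat.beq (sel (Nat.beq (Nat.land (Nat.shiftRight table x) 1) 1) 1 0)
      (sel (Nat.beq (filt idx fun b => bt x 0 b).length 3) 1 0)) = true := by
  decide +kernel

theorem nb_row (H a : ℕ) : nb H a = filt idx fun b => bt (row H a) 0 b := by
  rw [nb, filt_eq, filt_eq]
  apply List.filter_congr
  intro b hb
  rw [bt_row H a b ((mem_idx b).1 hb), bt_eq]
  simp

theorem full_iff (H a : ℕ) : full H a = true ↔ (nb H a).length = 3 := by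
  have hlt : row H a < 1024 := Nat.mod_lt _ (by norm_num)
  have h := (allL_iff _ _).1 table_spec (row H a) (List.mem_range.2 hlt)
  rw [← nb_row] at h
  have h2 := Nat.eq_of_beq_eq_true h
  simp only [sel_eq] at h2
  have hb : (nb H a).length = 3 ↔ Nat.beq (nb H a).length 3 = true :=
    ⟨fun e => by rw [e]; rfl, Nat.eq_of_beq_eq_true⟩
  rw [full, hb]
  split_ifs at h2 with h3 h4 h4
  · exact iff_of_true h3 h4
  · exact iff_of_false h3 h4

theorem digit (n : ℕ) : ∀ (d : ℕ → ℕ) (a : ℕ), a < n → (∀ b, d b < 1024) →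
    (∑ b ∈ Finset.range n, d b * 1024 ^ b) / 1024 ^ a % 1024 = d a := by
  induction n with
  | zero => intro d a h; omega
  | succ n ih =>
    intro d a ha hd
    have e : ∑ b ∈ Finset.range (n + 1), d b * 1024 ^ b =
        1024 * (∑ b ∈ Finset.range n, d (b + 1) * 1024 ^ b) + d 0 := by
      rw [Finset.sum_range_succ', Finset.mul_sum]
      congr 1
      · apply Finset.sum_congr rfl
        intro b _
        rw [pow_succ]; ring
      · simp
    rw [e]
    have h0 := hd 0
    cases a with
    | zero => rw [pow_zero, Nat.div_one]; omega
    | succ a =>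
      rw [pow_succ', ← Nat.div_div_eq_div_mul]
      have : (1024 * (∑ b ∈ Finset.range n, d (b + 1) * 1024 ^ b) + d 0) / 1024 =
        ∑ b ∈ Finset.range n, d (b + 1) * 1024 ^ b := by omega
      rw [this]
      exact ih (fun b => d (b + 1)) a (by omega) (fun b => hd _)

set_option maxRecDepth 100000 in
theorem search_ok : search 26 0 0 0 = true := by decide +kernel

/-- The labelling `f` of the vertices by `0, …, 9` exhibits the partial graph `H` inside `G`. -/
structure Good {V : Type*} (G : SimpleGraph V) (H v m : ℕ) (f : ℕ → V) : Prop where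
  inj : ∀ a b, a < 10 → b < 10 → f a = f b → a = b
  sub : ∀ a b, a < 10 → b < 10 → bt H a b = true → G.Adj (f a) (f b)
  sym : ∀ a b, a < 10 → b < 10 → bt H a b = true → bt H b a = true
  ord : ∀ x, x < 10 → x < m → iso H x = false → bt H v x = false → ¬ G.Adj (f v) (f x)

/-- The trace condition. -/
def TraceCond {V : Type*} [Fintype V] (G : SimpleGraph V) : Prop :=
  ((G.adjMatrix ℕ) ^ 6).trace + 810 ≤ 12 * ((G.adjMatrix ℕ) ^ 4).trace ∨
  ((G.adjMatrix ℕ) ^ 6).trace + 2616 ≤ 23 * ((G.adjMatrix ℕ) ^ 4).trace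

section
variable {V : Type*} [Fintype V] (G : SimpleGraph V)

theorem sum_V (hcard : Fintype.card V = 10) (f : ℕ → V)
    (inj : ∀ a b, a < 10 → b < 10 → f a = f b → a = b) (g : V → ℕ) :
    ∑ x, g x = ∑ a ∈ Finset.range 10, g (f a) := by
  have hi : Set.InjOn f (Finset.range 10 : Set ℕ) := by
    intro a ha b hb h
    exact inj a b (by simpa using ha) (by simpa using hb) h
  have : (Finset.univ : Finset V) = (Finset.range 10).image f := by
    symm
    apply Finset.eq_univ_of_card
    rw [Finset.card_image_of_injOn hi, hcard, Finset.card_range]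
  rw [this, Finset.sum_image hi]

theorem nb_card (H a : ℕ) : (nb H a).length = ((Finset.range 10).filter fun b => bt H a b).card := by
  have : (nb H a).toFinset = (Finset.range 10).filter fun b => bt H a b := by
    ext b
    rw [nb, filt_eq]
    simp [mem_idx]
  rw [← this, List.toFinset_card_of_nodup]
  rw [nb, filt_eq, idx_eq]
  exact List.nodup_range.filter _

theorem image_sub {H v m : ℕ} {f : ℕ → V} (hg : Good G H v m f) (a : ℕ) (ha : a < 10) :
    ((Finset.range 10).filter fun b => bt H a b).image f ⊆ G.neighborFinset (f a) := by
  intro x hx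
  simp only [Finset.mem_image, Finset.mem_filter, Finset.mem_range] at hx
  obtain ⟨b, ⟨hb, hbt⟩, rfl⟩ := hx
  rw [SimpleGraph.mem_neighborFinset]
  exact hg.sub a b ha hb hbt

theorem image_card {H v m : ℕ} {f : ℕ → V} (hg : Good G H v m f) (a : ℕ) :
    (((Finset.range 10).filter fun b => bt H a b).image f).card = (nb H a).length := by
  rw [Finset.card_image_of_injOn, nb_card]
  intro x hx y hy h
  simp only [Finset.coe_filter, Finset.mem_range, Set.mem_ofPred_eq] at hx hy
  exact hg.inj x y hx.1 hy.1 h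

theorem bt_of_full (hreg : G.IsRegularOfDegree 3) {H v m : ℕ} {f : ℕ → V} (hg : Good G H v m f)
    (a b : ℕ) (ha : a < 10) (hb : b < 10) (hf : full H a = true) (h : G.Adj (f a) (f b)) :
    bt H a b = true := by
  have he := Finset.eq_of_subset_of_card_le (image_sub G hg a ha) (by
    rw [image_card G hg a, (full_iff H a).1 hf]
    exact (hreg (f a)).le)
  have : f b ∈ G.neighborFinset (f a) := by rwa [SimpleGraph.mem_neighborFinset]
  rw [← he] at this
  simp only [Finset.mem_image, Finset.mem_filter, Finset.mem_range] at this
  obtain ⟨c, ⟨hc, hbt⟩, hcb⟩ := this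
  rwa [← hg.inj c b hc hb hcb]

theorem exists_new (hcard : Fintype.card V = 10) (hreg : G.IsRegularOfDegree 3)
    {H v m : ℕ} {f : ℕ → V} (hg : Good G H v m f)
    (hv : v < 10) (hf : full H v = false) :
    ∃ w, w < 10 ∧ G.Adj (f v) (f w) ∧ bt H v w = false := by
  by_contra hcon
  push Not at hcon
  have h3 : (nb H v).length ≠ 3 := fun h => by
    rw [(full_iff H v).2 h] at hf; exact absurd hf (by simp)
  apply h3
  rw [← image_card G hg v]
  have : ((Finset.range 10).filter fun b => bt H v b).image f = G.neighborFinset (f v) := by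
    apply (image_sub G hg v hv).antisymm
    intro x hx
    rw [SimpleGraph.mem_neighborFinset] at hx
    have hs := sum_V hcard f hg.inj (fun y => if y = x then 1 else 0)
    rw [Finset.sum_ite_eq' Finset.univ x, if_pos (Finset.mem_univ _)] at hs
    obtain ⟨c, hc, hne⟩ := Finset.exists_ne_zero_of_sum_ne_zero (hs ▸ one_ne_zero)
    have hcx : f c = x := by
      by_contra h; exact hne (if_neg h)
    subst hcx
    have hc' := Finset.mem_range.1 hc
    have := hcon c hc' hx
    exact Finset.mem_image_of_mem f (Finset.mem_filter.2 ⟨hc, by simpa using this⟩)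
  rw [this]
  exact hreg (f v)

theorem pow_le (hreg : G.IsRegularOfDegree 3) (k : ℕ) (x y : V) :
    ((G.adjMatrix ℕ) ^ k) x y ≤ 3 ^ k := by
  induction k generalizing x with
  | zero =>
    rw [pow_zero, pow_zero, Matrix.one_apply]; split_ifs <;> simp
  | succ k ih =>
    rw [pow_succ', SimpleGraph.adjMatrix_mul_apply]
    calc _ ≤ ∑ u ∈ G.neighborFinset x, 3 ^ k := Finset.sum_le_sum fun u _ => ih u
      _ = 3 ^ (k + 1) := by
        rw [Finset.sum_const, SimpleGraph.card_neighborFinset_eq_degree, hreg x, pow_succ']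
        rfl

theorem walk_eq (hcard : Fintype.card V = 10) (f : ℕ → V) (H : ℕ)
    (inj : ∀ a b, a < 10 → b < 10 → f a = f b → a = b)
    (hbt : ∀ a b, a < 10 → b < 10 → (bt H a b = true ↔ G.Adj (f a) (f b))) (k a : ℕ) (ha : a < 10) :
    walk H k a = ∑ b ∈ Finset.range 10, ((G.adjMatrix ℕ) ^ k) (f a) (f b) * 1024 ^ b := by
  induction k generalizing a with
  | zero =>
    have : walk H 0 a = 1024 ^ a := rfl
    rw [this, Finset.sum_eq_single a]
    · simp
    · intro b hb hne
      have : f a ≠ f b := fun h => hne (inj a b ha (Finset.mem_range.1 hb) h).symm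
      rw [pow_zero, Matrix.one_apply_ne this, zero_mul]
    · intro h; exact absurd (Finset.mem_range.2 ha) h
  | succ k ih =>
    have : walk H (k + 1) a = sumL (nb H a) (walk H k) := rfl
    rw [this, nb, sumL_filt, idx_sum]
    have e : ∀ b, ((G.adjMatrix ℕ) ^ (k + 1)) (f a) (f b) =
        ∑ c ∈ Finset.range 10,
          if bt H a c = true then ((G.adjMatrix ℕ) ^ k) (f c) (f b) else 0 := by
      intro b
      rw [pow_succ', Matrix.mul_apply, sum_V hcard f inj]
      apply Finset.sum_congr rfl
      intro c hc
      rw [SimpleGraph.adjMatrix_apply]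
      have := hbt a c ha (Finset.mem_range.1 hc)
      by_cases h : G.Adj (f a) (f c)
      · rw [if_pos h, if_pos (this.2 h), one_mul]
      · rw [if_neg h, if_neg (fun h' => h (this.1 h')), zero_mul]
    simp only [e, Finset.sum_mul]
    rw [Finset.sum_comm]
    apply Finset.sum_congr rfl
    intro c hc
    split_ifs with h
    · exact ih c (Finset.mem_range.1 hc)
    · simp

theorem tr_eq (hcard : Fintype.card V = 10) (hreg : G.IsRegularOfDegree 3) (f : ℕ → V) (H : ℕ)
    (inj : ∀ a b, a < 10 → b < 10 → f a = f b → a = b)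
    (hbt : ∀ a b, a < 10 → b < 10 → (bt H a b = true ↔ G.Adj (f a) (f b))) (k : ℕ) (hk : k ≤ 6) :
    tr H k = ((G.adjMatrix ℕ) ^ k).trace := by
  rw [Matrix.trace, sum_V hcard f inj, tr, sumL_idx]
  apply Finset.sum_congr rfl
  intro a ha
  have ha' := Finset.mem_range.1 ha
  rw [walk_eq G hcard f H inj hbt k a ha']
  refine digit 10 (fun b => ((G.adjMatrix ℕ) ^ k) (f a) (f b)) a ha' ?_
  intro b
  calc _ ≤ 3 ^ k := pow_le G hreg k _ _
    _ ≤ 3 ^ 6 := Nat.pow_le_pow_right (by norm_num) hk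
    _ < 1024 := by norm_num

theorem leaf_sound (hcard : Fintype.card V = 10) (hreg : G.IsRegularOfDegree 3)
    {H v m : ℕ} {f : ℕ → V} (hg : Good G H v m f) (h : leaf H = true) : TraceCond G := by
  rw [leaf, sel_eq, sel_eq] at h
  split_ifs at h with h1 h2
  all_goals
    have hbt : ∀ a b, a < 10 → b < 10 → (bt H a b = true ↔ G.Adj (f a) (f b)) := fun a b ha hb =>
      ⟨hg.sub a b ha hb, bt_of_full G hreg hg a b ha hb
        ((allL_iff _ _).1 h1 a ((mem_idx a).2 ha))⟩
    have e4 := tr_eq G hcard hreg f H hg.inj hbt 4 (by norm_num)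
    have e6 := tr_eq G hcard hreg f H hg.inj hbt 6 (by norm_num)
    rw [TraceCond, ← e4, ← e6]
  · exact Or.inl (Nat.le_of_ble_eq_true h2)
  · exact Or.inr (Nat.le_of_ble_eq_true h)

theorem iso_of_bt (H a b : ℕ) (hb : b < 10) (h : bt H a b = true) : iso H a = false := by
  by_contra hc
  rw [iso_bt H a b hb (by simpa using hc)] at h
  exact absurd h (by simp)

theorem iso_mono (H v w x : ℕ) (hv : v < 10) (hw : w < 10) (hx : x < 10)
    (hxv : x ≠ v) (hxw : x ≠ w) (h : iso H x = true) : iso (ad H v w) x = true := by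
  have : row (ad H v w) x = 0 := by
    apply Nat.eq_of_testBit_eq
    intro i
    rw [Nat.zero_testBit]
    by_cases hi : i < 10
    · rw [← bt_row _ _ _ hi]
      by_contra hc
      have := (bt_ad H v w x i hv hw hi).1 (by simpa using hc)
      rw [iso_bt H x i hi h] at this
      simp [hxv, hxw] at this
    · have : row (ad H v w) x < 2 ^ 10 := Nat.mod_lt _ (by norm_num)
      apply Nat.testBit_lt_two_pow
      exact this.trans_le (Nat.pow_le_pow_right (by norm_num) (by omega))
  rw [iso, this]; rfl

theorem search_sound (hcard : Fintype.card V = 10) (hreg : G.IsRegularOfDegree 3) (n : ℕ) :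
    ∀ (H v m : ℕ) (f : ℕ → V), v < 10 → Good G H v m f → search n H v m = true →
      TraceCond G := by
  induction n with
  | zero => intro H v m f _ _ h; exact absurd h (by simp [search])
  | succ n ih =>
    intro H v m f hv hg h
    have hdef : search (n + 1) H v m =
      sel (full H v) (sel (Nat.beq v 9) (leaf H) (search n H (Nat.succ v) 0))
        (allL idx fun w => sel (blocked H v m w) true
          (search n (ad H v w) v (sel (iso H w) 10 (Nat.succ w)))) := rfl
    rw [hdef, sel_eq] at h
    split_ifs at h with hf
    · rw [sel_eq] at h
      split_ifs at h with h9
      · exact leaf_sound G hcard hreg hg h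
      · have h9' : v ≠ 9 := fun e => h9 (by rw [e]; rfl)
        exact ih H (v + 1) 0 f (by omega)
          ⟨hg.inj, hg.sub, hg.sym, fun x _ h0 => absurd h0 (by omega)⟩ h
    · rw [allL_iff] at h
      -- a non-isolated new neighbour, the least one, or else an isolated one
      have key : ∀ w, ∀ f : ℕ → V, Good G H v m f → w < 10 → G.Adj (f v) (f w) →
          bt H v w = false →
          (∀ x, x < 10 → (iso H w = false → x < w) → iso H x = false → bt H v x = false →
            ¬ G.Adj (f v) (f x)) → TraceCond G := by
        intro w
        induction w using Nat.strong_induction_on with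
        | _ w ihw =>
        intro f hg hw hadj hbw hmin
        have hwv : w ≠ v := fun e => by rw [e] at hadj; exact G.loopless.irrefl _ hadj
        have hb := h w ((mem_idx w).2 hw)
        rw [sel_eq] at hb
        split_ifs at hb with hbl
        · -- blocked
          rw [blocked, sel_eq, sel_eq, sel_eq, sel_eq, sel_eq] at hbl
          split_ifs at hbl with c1 c2 c3 c4 c5
          · exact absurd (Nat.eq_of_beq_eq_true c1) hwv
          · have := bt_of_full G hreg hg w v hw hv c2 hadj.symm
            rw [hg.sym w v hw hv this] at hbw
            exact absurd hbw (by simp)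
          · rw [c3] at hbw; exact absurd hbw (by simp)
          · -- a smaller isolated vertex
            rw [allL_iff] at c5
            push Not at c5
            obtain ⟨u, hu, hu2⟩ := c5
            rw [mem_idx] at hu
            rw [sel_eq, sel_eq, sel_eq] at hu2
            split_ifs at hu2 with d1 d2 d3
            · exact absurd rfl hu2
            · exact absurd rfl hu2
            · have huw : u < w := by
                by_contra hc
                exact d1 (Nat.ble_eq_true_of_le (by omega))
              have huv : u ≠ v := fun e => d2 (by rw [e]; exact Nat.beq_refl v)
              have hsw : ∀ x, x ≠ u → x ≠ w → Equiv.swap u w x = x :=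
                fun x h1 h2 => Equiv.swap_apply_of_ne_of_ne h1 h2
              have hlt : ∀ x, x < 10 → Equiv.swap u w x < 10 := by
                intro x hx
                rw [Equiv.swap_apply_def]; split_ifs <;> assumption
              have hni : ∀ x, iso H x = false → Equiv.swap u w x = x := by
                intro x hx
                apply hsw
                · intro e; rw [e, d3] at hx; exact absurd hx (by simp)
                · intro e; rw [e, c4] at hx; exact absurd hx (by simp)
              have hfv : Equiv.swap u w v = v := hsw v huv.symm hwv.symm
              refine ihw u huw (f ∘ Equiv.swap u w) ⟨?_, ?_, hg.sym, ?_⟩ hu ?_ ?_ ?_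
              · intro a b ha hb e
                exact (Equiv.swap u w).injective (hg.inj _ _ (hlt a ha) (hlt b hb) e)
              · intro a b ha hb e
                simp only [Function.comp]
                rw [hni a (iso_of_bt H a b hb e), hni b (iso_of_bt H b a ha (hg.sym a b ha hb e))]
                exact hg.sub a b ha hb e
              · intro x hx hxm hix hbx
                simp only [Function.comp]
                rw [hfv, hni x hix]
                exact hg.ord x hx hxm hix hbx
              · simp only [Function.comp]
                rw [hfv, Equiv.swap_apply_left]
                exact hadj
              · by_contra hc
                have := hg.sym v u hv hu (by simpa using hc)
                rw [iso_bt H u v hv d3] at this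
                exact absurd this (by simp)
              · intro x hx _ hix hbx
                simp only [Function.comp]
                rw [hfv, hni x hix]
                exact hmin x hx (fun e => by rw [c4] at e; exact absurd e (by simp)) hix hbx
            · exact absurd rfl hu2
          · exact hg.ord w hw (Nat.le_of_ble_eq_true hbl) (by simpa using c4) hbw hadj |>.elim
        · refine ih (ad H v w) v _ f hv ⟨hg.inj, ?_, ?_, ?_⟩ hb
          · intro a b ha hb' e
            rcases (bt_ad H v w a b hv hw hb').1 e with e | ⟨rfl, rfl⟩ | ⟨rfl, rfl⟩
            · exact hg.sub a b ha hb' e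
            · exact hadj
            · exact hadj.symm
          · intro a b ha hb' e
            rw [bt_ad H v w b a hv hw ha]
            rcases (bt_ad H v w a b hv hw hb').1 e with e | e | e
            · exact Or.inl (hg.sym a b ha hb' e)
            · exact Or.inr (Or.inr e.symm)
            · exact Or.inr (Or.inl e.symm)
          · intro x hx hxm hix hbx
            have hnot : ¬ (bt H v x = true ∨ (v = v ∧ x = w) ∨ (v = w ∧ x = v)) := by
              rw [← bt_ad H v w v x hv hw hx, hbx]; simp
            push Not at hnot
            have hxw : x ≠ w := hnot.2.1 rfl
            by_cases hxv : x = v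
            · rw [hxv]; exact G.loopless.irrefl _
            apply hmin x hx
            · intro hiw
              rw [sel_eq, hiw] at hxm
              simp at hxm
              omega
            · by_contra hc
              rw [iso_mono H v w x hv hw hx hxv hxw (by simpa using hc)] at hix
              exact absurd hix (by simp)
            · simpa using hnot.1
      by_cases hex : ∃ w, w < 10 ∧ G.Adj (f v) (f w) ∧ bt H v w = false ∧ iso H w = false
      · have hs := Nat.find_spec hex
        refine key (Nat.find hex) f hg hs.1 hs.2.1 hs.2.2.1 ?_
        intro x hx hlt hix hbx hadj
        exact Nat.find_min hex (hlt hs.2.2.2) ⟨hx, hadj, hbx, hix⟩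
      · obtain ⟨w, hw, hadj, hbw⟩ := exists_new G hcard hreg hg hv (by simpa using hf)
        refine key w f hg hw hadj hbw ?_
        intro x hx _ hix hbx hadj'
        exact hex ⟨x, hx, hadj', hbx, hix⟩

theorem traceCond (hcard : Fintype.card V = 10) (hreg : G.IsRegularOfDegree 3) :
    TraceCond G := by
  let e : Fin 10 ≃ V := (Fintype.equivFinOfCardEq hcard).symm
  refine search_sound G hcard hreg 26 0 0 0 (fun a => e (Fin.ofNat 10 a)) (by norm_num)
    ⟨?_, ?_, ?_, ?_⟩ search_ok
  · intro a b ha hb h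
    have := congrArg Fin.val (e.injective h)
    simp only [Fin.ofNat, Nat.mod_eq_of_lt ha, Nat.mod_eq_of_lt hb] at this
    exact this
  · intro a b _ _ h
    rw [bt_eq, Nat.zero_testBit] at h; exact absurd h (by simp)
  · intro a b _ _ h
    rw [bt_eq, Nat.zero_testBit] at h; exact absurd h (by simp)
  · intro x _ h; exact absurd h (by omega)

end

theorem trace_pow_eq {V : Type*} [Fintype V] (A : Matrix V V ℝ) (hA : A.IsHermitian) (k : ℕ) :
    (A ^ k).trace = ∑ i, hA.eigenvalues i ^ k := by
  conv_lhs => rw [hA.spectral_theorem, ← map_pow, Matrix.diagonal_pow,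
    Unitary.conjStarAlgAut_apply, Matrix.trace_mul_comm, ← mul_assoc]
  simp [Matrix.trace]

theorem three_eigenvalue {V : Type*} [Fintype V] (G : SimpleGraph V)
    (hcard : Fintype.card V = 10) (hreg : G.IsRegularOfDegree 3)
    (hA : (G.adjMatrix ℝ).IsHermitian) : ∃ i, hA.eigenvalues i = 3 := by
  have hmem : (3 : ℝ) ∈ spectrum ℝ (G.adjMatrix ℝ) := by
    rw [spectrum.mem_iff, Matrix.isUnit_iff_isUnit_det, isUnit_iff_ne_zero, not_not,
      ← Matrix.exists_mulVec_eq_zero_iff]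
    refine ⟨fun _ => 1, ?_, ?_⟩
    · have : Nonempty V := Fintype.card_pos_iff.1 (by omega)
      intro h
      have := congrFun h (Classical.arbitrary V)
      simp at this
    · ext x
      rw [Matrix.sub_mulVec, Pi.sub_apply, SimpleGraph.adjMatrix_mulVec_apply,
        Algebra.algebraMap_eq_smul_one, Matrix.smul_mulVec, Matrix.one_mulVec]
      have h3 : G.degree x = 3 := hreg x
      simp [h3]
  rw [hA.spectrum_real_eq_range_eigenvalues] at hmem
  exact hmem

theorem cast_trace {V : Type*} [Fintype V] (G : SimpleGraph V) (k : ℕ) :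
    ((G.adjMatrix ℝ) ^ k).trace = (((G.adjMatrix ℕ) ^ k).trace : ℝ) := by
  have h : G.adjMatrix ℝ = (Nat.castRingHom ℝ).mapMatrix (G.adjMatrix ℕ) := by
    ext i j
    simp [SimpleGraph.adjMatrix_apply]
  rw [h, ← map_pow]
  simp [Matrix.trace]

theorem trace_sq {V : Type*} [Fintype V] (G : SimpleGraph V)
    (hcard : Fintype.card V = 10) (hreg : G.IsRegularOfDegree 3) :
    ((G.adjMatrix ℝ) ^ 2).trace = 30 := by
  have h : ∀ x, ((G.adjMatrix ℝ) ^ 2) x x = 3 := by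
    intro x
    have h3 : G.degree x = 3 := hreg x
    rw [pow_two, SimpleGraph.adjMatrix_mul_self_apply_self, h3]; norm_num
  simp only [Matrix.trace, Matrix.diag, h, Finset.sum_const, Finset.card_univ, hcard]
  norm_num

theorem poly1 (x : ℝ) : 108 * |x| ≤ x ^ 6 - 12 * x ^ 4 + 75 * x ^ 2 + 44 := by
  have e2 : x ^ 2 = |x| ^ 2 := (sq_abs x).symm
  have e4 : x ^ 4 = |x| ^ 4 := by rw [show (4 : ℕ) = 2 * 2 by rfl, pow_mul, pow_mul, sq_abs]
  have e6 : x ^ 6 = |x| ^ 6 := by rw [show (6 : ℕ) = 2 * 3 by rfl, pow_mul, pow_mul, sq_abs]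
  have h0 := abs_nonneg x
  rw [e2, e4, e6]
  generalize |x| = s at h0
  have : 0 ≤ (s - 1) ^ 2 * (s - 2) ^ 2 * (s ^ 2 + 6 * s + 11) := by positivity
  nlinarith [this]

theorem poly2 (x : ℝ) : 384 * |x| ≤ x ^ 6 - 23 * x ^ 4 + 235 * x ^ 2 + 171 := by
  have e2 : x ^ 2 = |x| ^ 2 := (sq_abs x).symm
  have e4 : x ^ 4 = |x| ^ 4 := by rw [show (4 : ℕ) = 2 * 2 by rfl, pow_mul, pow_mul, sq_abs]
  have e6 : x ^ 6 = |x| ^ 6 := by rw [show (6 : ℕ) = 2 * 3 by rfl, pow_mul, pow_mul, sq_abs]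
  have h0 := abs_nonneg x
  rw [e2, e4, e6]
  generalize |x| = s at h0
  have : 0 ≤ (s - 1) ^ 2 * (s - 3) ^ 2 * (s ^ 2 + 8 * s + 19) := by positivity
  nlinarith [this]

end

end CubicTen

theorem energy_le_of_cubic_card_ten {V : Type*} [Fintype V] (G : SimpleGraph V)
    (hcard : Fintype.card V = 10) (hreg : G.IsRegularOfDegree 3) :
    G.energy ≤ 16 := by
  have hA : (G.adjMatrix ℝ).IsHermitian := by
    rw [Matrix.IsHermitian, Matrix.conjTranspose_eq_transpose_of_trivial]
    exact SimpleGraph.transpose_adjMatrix G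
  rw [SimpleGraph.energy, matrixEnergy, dif_pos hA]
  obtain ⟨i₀, hi₀⟩ := CubicTen.three_eigenvalue G hcard hreg hA
  have t2 := CubicTen.trace_sq G hcard hreg
  have t4 := CubicTen.cast_trace G 4
  have t6 := CubicTen.cast_trace G 6
  rw [CubicTen.trace_pow_eq _ hA] at t2 t4 t6
  have hc := CubicTen.traceCond G hcard hreg
  rw [CubicTen.TraceCond] at hc
  generalize ((G.adjMatrix ℕ) ^ 4).trace = n4 at t4 hc
  generalize ((G.adjMatrix ℕ) ^ 6).trace = n6 at t6 hc
  generalize hA.eigenvalues = l at *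
  have split : ∀ g : V → ℝ, ∑ i, g i = g i₀ + ∑ i ∈ Finset.univ.erase i₀, g i := fun g =>
    (Finset.add_sum_erase _ _ (Finset.mem_univ i₀)).symm
  have hc9 : (Finset.univ.erase i₀).card = 9 := by
    rw [Finset.card_erase_of_mem (Finset.mem_univ _), Finset.card_univ, hcard]
  rw [split, hi₀] at t2 t4 t6 ⊢
  have b1 : 108 * ∑ i ∈ Finset.univ.erase i₀, |l i| ≤
      ∑ i ∈ Finset.univ.erase i₀, l i ^ 6 - 12 * ∑ i ∈ Finset.univ.erase i₀, l i ^ 4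
        + 75 * ∑ i ∈ Finset.univ.erase i₀, l i ^ 2 + 9 * 44 := by
    have := Finset.sum_le_sum (s := Finset.univ.erase i₀) fun i _ => CubicTen.poly1 (l i)
    simp only [Finset.sum_add_distrib, Finset.sum_sub_distrib, ← Finset.mul_sum,
      Finset.sum_const, hc9, nsmul_eq_mul] at this
    exact_mod_cast this
  have b2 : 384 * ∑ i ∈ Finset.univ.erase i₀, |l i| ≤
      ∑ i ∈ Finset.univ.erase i₀, l i ^ 6 - 23 * ∑ i ∈ Finset.univ.erase i₀, l i ^ 4
        + 235 * ∑ i ∈ Finset.univ.erase i₀, l i ^ 2 + 9 * 171 := by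
    have := Finset.sum_le_sum (s := Finset.univ.erase i₀) fun i _ => CubicTen.poly2 (l i)
    simp only [Finset.sum_add_distrib, Finset.sum_sub_distrib, ← Finset.mul_sum,
      Finset.sum_const, hc9, nsmul_eq_mul] at this
    exact_mod_cast this
  rw [show |(3 : ℝ)| = 3 by norm_num]
  rcases hc with hc | hc
  · have hc' : (n6 : ℝ) + 810 ≤ 12 * n4 := by exact_mod_cast hc
    linarith
  · have hc' : (n6 : ℝ) + 2616 ≤ 23 * n4 := by exact_mod_cast hc
    linarith
end

section
/- There exist two connected 3-regular simple graphs G and H on 10 vertices whose adjacency matrices have the same permanent but which have different energies, i.e., per(A(G)) = per(A(H)) and E(G) ≠ E(H). -/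
open scoped Classical

open Polynomial in
theorem trace_aeval_eq {A : Matrix (Fin 10) (Fin 10) ℝ} (h : A.IsHermitian) (q : ℝ[X]) :
    (aeval A q).trace = ∑ i, q.eval (h.eigenvalues i) := by
  have h1 := h.spectral_theorem
  have h2 : aeval A q = Unitary.conjStarAlgAut ℝ _ h.eigenvectorUnitary
      (aeval (Matrix.diagonal (RCLike.ofReal ∘ h.eigenvalues)) q) := by
    conv_lhs => rw [h1]
    exact Polynomial.aeval_algHom_apply
      (Unitary.conjStarAlgAut ℝ (Matrix (Fin 10) (Fin 10) ℝ) h.eigenvectorUnitary) _ q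
  have h3 : aeval (Matrix.diagonal ((RCLike.ofReal : ℝ → ℝ) ∘ h.eigenvalues)) q
      = Matrix.diagonal (aeval ((RCLike.ofReal : ℝ → ℝ) ∘ h.eigenvalues) q) :=
    Polynomial.aeval_algHom_apply (Matrix.diagonalAlgHom (n := Fin 10) (α := ℝ) ℝ) _ q
  rw [h2, h3, Unitary.conjStarAlgAut_apply, Matrix.trace_mul_comm, ← mul_assoc]
  simp only [Unitary.coe_star_mul_self, one_mul, Matrix.trace_diagonal]
  refine Finset.sum_congr rfl fun i _ => ?_
  have h4 := Polynomial.aeval_algHom_apply (Pi.evalAlgHom ℝ (fun _ : Fin 10 => ℝ) i)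
    ((RCLike.ofReal : ℝ → ℝ) ∘ h.eigenvalues) q
  simp only [Pi.evalAlgHom_apply] at h4
  rw [← h4]
  simp [Polynomial.aeval_def, Polynomial.eval₂_eq_eval_map]

open Polynomial in
theorem eval_eigenvalue_eq_zero {A : Matrix (Fin 10) (Fin 10) ℝ} (h : A.IsHermitian) (q : ℝ[X])
    (hq : aeval A q = 0) (i : Fin 10) : q.eval (h.eigenvalues i) = 0 := by
  have h1 := trace_aeval_eq h (q * q)
  rw [map_mul, hq] at h1
  simp only [mul_zero, Matrix.trace_zero, eval_mul] at h1
  have h2 := (Finset.sum_eq_zero_iff_of_nonneg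
    (fun i _ => mul_self_nonneg (q.eval (h.eigenvalues i)))).1 h1.symm i (Finset.mem_univ i)
  exact mul_self_eq_zero.1 h2

/-- Permanent by expansion along the first column, skipping zero entries. -/
def perRec : (n : ℕ) → (Fin n → Fin n → ℤ) → ℤ
  | 0, _ => 1
  | n + 1, M => ∑ p : Fin (n + 1), if M p 0 = 0 then 0 else
      M p 0 * perRec n (fun i j => M (Equiv.swap 0 p i.succ) j.succ)

theorem permanent_eq_perRec (n : ℕ) (M : Matrix (Fin n) (Fin n) ℤ) :
    M.permanent = perRec n M := by
  induction n with
  | zero => simp [Matrix.permanent, perRec]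
  | succ n ih =>
    rw [Matrix.permanent, ← Equiv.sum_comp Equiv.Perm.decomposeFin.symm, Fintype.sum_prod_type]
    show _ = ∑ p : Fin (n + 1), if M p 0 = 0 then 0 else
      M p 0 * perRec n (fun i j => M (Equiv.swap 0 p i.succ) j.succ)
    refine Finset.sum_congr rfl fun p _ => ?_
    have : (∑ e : Equiv.Perm (Fin n), ∏ i, M (Equiv.Perm.decomposeFin.symm (p, e) i) i)
        = M p 0 * perRec n (fun i j => M (Equiv.swap 0 p i.succ) j.succ) := by
      have h := ih (Matrix.of fun i j => M (Equiv.swap 0 p i.succ) j.succ)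
      have h' : perRec n (fun i j => M (Equiv.swap 0 p i.succ) j.succ) =
        perRec n (Matrix.of fun i j => M (Equiv.swap 0 p i.succ) j.succ) := rfl
      rw [h', ← h, Matrix.permanent, Finset.mul_sum]
      refine Finset.sum_congr rfl fun e _ => ?_
      rw [Fin.prod_univ_succ]
      simp
    rw [this]
    split_ifs with h0
    · rw [h0, zero_mul]
    · rfl

/-- Neighbour lists of the Petersen graph. -/
def nbG : Fin 10 → List (Fin 10) :=
  ![[1, 2, 3], [0, 4, 5], [0, 6, 7], [0, 8, 9], [1, 6, 8], [1, 7, 9], [2, 4, 9], [2, 5, 8],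
    [3, 4, 7], [3, 5, 6]]

/-- Neighbour lists of the second graph. -/
def nbH : Fin 10 → List (Fin 10) :=
  ![[1, 2, 3], [0, 2, 4], [0, 1, 5], [0, 6, 7], [1, 6, 8], [2, 7, 9], [3, 4, 8], [3, 5, 9],
    [4, 6, 9], [5, 7, 8]]

/-- The 0-1 matrix of a neighbour-list function. -/
def nbMat (nb : Fin 10 → List (Fin 10)) : Matrix (Fin 10) (Fin 10) ℤ :=
  fun i j => if j ∈ nb i then 1 else 0

/-- The graph of a neighbour-list function. -/
def nbGraph (nb : Fin 10 → List (Fin 10)) (h1 : ∀ i j, j ∈ nb i → i ∈ nb j)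
    (h2 : ∀ i, i ∉ nb i) : SimpleGraph (Fin 10) where
  Adj i j := j ∈ nb i
  symm := ⟨fun i j h => h1 i j h⟩
  loopless := ⟨fun i h => h2 i h⟩

theorem nbGraph_adjMatrix (R : Type*) [Ring R] (nb : Fin 10 → List (Fin 10)) (h1 h2)
    [DecidableRel (nbGraph nb h1 h2).Adj] :
    (nbGraph nb h1 h2).adjMatrix R = (nbMat nb).map (Int.castRingHom R) := by
  ext i j
  have h : (nbGraph nb h1 h2).Adj i j ↔ j ∈ nb i := Iff.rfl
  simp [SimpleGraph.adjMatrix_apply, h, nbMat]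

theorem nbGraph_connected (nb : Fin 10 → List (Fin 10)) (h1 h2)
    (h : ∀ i : Fin 10, i ≠ 0 → ∃ j ∈ nb i, j < i) : (nbGraph nb h1 h2).Connected := by
  have key : ∀ i : Fin 10, (nbGraph nb h1 h2).Reachable i 0 := by
    intro i
    induction i using WellFoundedLT.induction with
    | ind i ih =>
      by_cases hi : i = 0
      · rw [hi]
      · obtain ⟨j, hj, hji⟩ := h i hi
        have : (nbGraph nb h1 h2).Adj i j := hj
        exact this.reachable.trans (ih j hji)
  exact { preconnected := fun u v => (key u).trans (key v).symm, nonempty := ⟨0⟩ }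

theorem nbGraph_regular (nb : Fin 10 → List (Fin 10)) (h1 h2)
    [(nbGraph nb h1 h2).LocallyFinite]
    (h : ∀ i, (nb i).toFinset.card = 3) : (nbGraph nb h1 h2).IsRegularOfDegree 3 := by
  intro i
  rw [← h i, ← SimpleGraph.card_neighborFinset_eq_degree]
  congr 1
  ext j
  rw [SimpleGraph.mem_neighborFinset, List.mem_toFinset]
  exact Iff.rfl

theorem symmG : ∀ i j, j ∈ nbG i → i ∈ nbG j := by decide
theorem looplessG : ∀ i, i ∉ nbG i := by decide
theorem symmH : ∀ i j, j ∈ nbH i → i ∈ nbH j := by decide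
theorem looplessH : ∀ i, i ∉ nbH i := by decide

theorem perG : perRec 10 (nbMat nbG) = 60 := by decide +kernel
theorem perH : perRec 10 (nbMat nbH) = 60 := by decide +kernel

theorem minpolyG : (nbMat nbG - 3) * (nbMat nbG - 1) * (nbMat nbG + 2) = 0 := by decide +kernel
theorem minpolyH : (nbMat nbH - 3) * (nbMat nbH - 1) * (nbMat nbH + 2)
    * (nbMat nbH ^ 3 - 3 * nbMat nbH - 1) = 0 := by decide +kernel
theorem traceG : (4 * nbMat nbG ^ 2 - nbMat nbG + 12).trace = 240 := by decide +kernel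
theorem traceH : (239 * nbMat nbH ^ 5 - 1061 * nbMat nbH ^ 4 - 1395 * nbMat nbH ^ 3
    + 11944 * nbMat nbH ^ 2 + 2195 * nbMat nbH + 6078).trace = 285030 := by decide +kernel

theorem matrixEnergy_eq {A : Matrix (Fin 10) (Fin 10) ℝ} (h : A.IsHermitian) :
    matrixEnergy A = ∑ i, |h.eigenvalues i| := by
  rw [matrixEnergy, dif_pos h]
  congr!

/-- Real version of an integer 0-1 matrix. -/
noncomputable def rMat (nb : Fin 10 → List (Fin 10)) : Matrix (Fin 10) (Fin 10) ℝ :=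
  (nbMat nb).map (Int.castRingHom ℝ)

open Polynomial in
theorem aeval_rMat (nb : Fin 10 → List (Fin 10)) (q : ℤ[X]) :
    aeval (rMat nb) (q.map (Int.castRingHom ℝ)) = (aeval (nbMat nb) q).map (Int.castRingHom ℝ) := by
  have h := Polynomial.aeval_algHom_apply
    ((Int.castRingHom ℝ).mapMatrix (m := Fin 10)).toIntAlgHom (nbMat nb) q
  refine Eq.trans ?_ h
  have := Polynomial.aeval_map_algebraMap ℝ (rMat nb) q
  exact this

open Polynomial in
theorem minpoly_int (nb : Fin 10 → List (Fin 10)) (h : (rMat nb).IsHermitian) (q : ℤ[X])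
    (hq : aeval (nbMat nb) q = 0) (i : Fin 10) :
    (q.map (Int.castRingHom ℝ)).eval (h.eigenvalues i) = 0 := by
  apply eval_eigenvalue_eq_zero
  rw [aeval_rMat, hq]
  ext; simp

open Polynomial in
theorem trace_int (nb : Fin 10 → List (Fin 10)) (h : (rMat nb).IsHermitian) (q : ℤ[X]) (t : ℤ)
    (hq : (aeval (nbMat nb) q).trace = t) :
    ∑ i, (q.map (Int.castRingHom ℝ)).eval (h.eigenvalues i) = t := by
  rw [← trace_aeval_eq, aeval_rMat, ← hq]
  simp [Matrix.trace]

open Polynomial in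
theorem energyG : matrixEnergy (rMat nbG) = 16 := by
  have h : (rMat nbG).IsHermitian := by
    rw [rMat, ← nbGraph_adjMatrix ℝ nbG symmG looplessG]
    exact SimpleGraph.isSymm_adjMatrix _
  rw [matrixEnergy_eq h]
  have ht := trace_int nbG h (4 * X ^ 2 - X + 12) 240 (by simpa only [map_mul, map_add, map_sub, map_pow, aeval_X, map_ofNat, map_one] using traceG)
  have hm := minpoly_int nbG h ((X - 3) * (X - 1) * (X + 2)) (by simpa only [map_mul, map_add, map_sub, map_pow, aeval_X, map_ofNat, map_one] using minpolyG)
  have hp : ∀ i, 15 * |h.eigenvalues i| =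
      ((4 * X ^ 2 - X + 12 : ℤ[X]).map (Int.castRingHom ℝ)).eval (h.eigenvalues i) := by
    intro i
    have hmi := hm i
    generalize h.eigenvalues i = x at *
    simp at hmi ⊢
    rcases hmi with (hx | hx) | hx
    · obtain rfl : x = 3 := by linarith
      norm_num
    · obtain rfl : x = 1 := by linarith
      norm_num
    · obtain rfl : x = -2 := by linarith
      norm_num
  rw [← Finset.sum_congr rfl (fun i _ => hp i), ← Finset.mul_sum] at ht
  push_cast at ht
  linarith

theorem cubic_bound (x : ℝ) (hx : x ^ 3 - 3 * x - 1 = 0) :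
    |x| ≤ x ^ 2 / 2 - x / 20 + 3 / 10 := by
  rw [abs_le']
  constructor
  · by_contra! hc
    have h1 : 33 / 100 < x := by nlinarith
    have h2 : x < 177 / 100 := by nlinarith
    nlinarith [mul_pos (sub_pos.2 h1) (sub_pos.2 h2), mul_pos (mul_pos (sub_pos.2 h1) (sub_pos.2 h2)) (by linarith : 0 < x)]
  · by_contra! hc
    have h1 : -151 / 100 < x := by nlinarith
    have h2 : x < -39 / 100 := by nlinarith
    nlinarith [mul_pos (sub_pos.2 h1) (sub_pos.2 h2), mul_pos (mul_pos (sub_pos.2 h1) (sub_pos.2 h2)) (by linarith : 0 < -x)]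

open Polynomial in
theorem energyH : matrixEnergy (rMat nbH) < 16 := by
  have h : (rMat nbH).IsHermitian := by
    rw [rMat, ← nbGraph_adjMatrix ℝ nbH symmH looplessH]
    exact SimpleGraph.isSymm_adjMatrix _
  rw [matrixEnergy_eq h]
  have ht := trace_int nbH h (239 * X ^ 5 - 1061 * X ^ 4 - 1395 * X ^ 3 + 11944 * X ^ 2 + 2195 * X + 6078)
    285030 (by simpa only [map_mul, map_add, map_sub, map_pow, aeval_X, map_ofNat, map_one] using traceH)
  have hm := minpoly_int nbH h ((X - 3) * (X - 1) * (X + 2) * (X ^ 3 - 3 * X - 1))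
    (by simpa only [map_mul, map_add, map_sub, map_pow, aeval_X, map_ofNat, map_one] using minpolyH)
  have hp : ∀ i, 18000 * |h.eigenvalues i| ≤
      ((239 * X ^ 5 - 1061 * X ^ 4 - 1395 * X ^ 3 + 11944 * X ^ 2 + 2195 * X + 6078 : ℤ[X]).map
        (Int.castRingHom ℝ)).eval (h.eigenvalues i) := by
    intro i
    have hmi := hm i
    generalize h.eigenvalues i = x at *
    simp at hmi ⊢
    rcases hmi with ((hx | hx) | hx) | hx
    · obtain rfl : x = 3 := by linarith
      norm_num
    · obtain rfl : x = 1 := by linarith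
      norm_num
    · obtain rfl : x = -2 := by linarith
      norm_num
    · have h1 := cubic_bound x hx
      have h2 : 239 * x ^ 5 - 1061 * x ^ 4 - 1395 * x ^ 3 + 11944 * x ^ 2 + 2195 * x + 6078
        = 18000 * (x ^ 2 / 2 - x / 20 + 3 / 10) := by
        linear_combination (239 * x ^ 2 - 1061 * x - 678) * hx
      rw [h2]
      linarith
  have hs := Finset.sum_le_sum (fun i (_ : i ∈ Finset.univ) => hp i)
  rw [ht, ← Finset.mul_sum] at hs
  push_cast at hs
  linarith

theorem exists_same_permanent_different_energy :
    ∃ G H : SimpleGraph (Fin 10), G.Connected ∧ H.Connected ∧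
      G.IsRegularOfDegree 3 ∧ H.IsRegularOfDegree 3 ∧
      (G.adjMatrix ℤ).permanent = (H.adjMatrix ℤ).permanent ∧
      G.energy ≠ H.energy := by
  refine ⟨nbGraph nbG symmG looplessG, nbGraph nbH symmH looplessH,
    nbGraph_connected _ _ _ (by decide), nbGraph_connected _ _ _ (by decide),
    nbGraph_regular _ _ _ (by decide), nbGraph_regular _ _ _ (by decide), ?_, ?_⟩
  · rw [nbGraph_adjMatrix, nbGraph_adjMatrix]
    have e : ∀ M : Matrix (Fin 10) (Fin 10) ℤ, M.map (Int.castRingHom ℤ) = M := by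
      intro M; ext; simp
    rw [e, e, permanent_eq_perRec, permanent_eq_perRec]
    exact perG.trans perH.symm
  · rw [SimpleGraph.energy, SimpleGraph.energy, nbGraph_adjMatrix, nbGraph_adjMatrix]
    have h1 := energyG
    have h2 := energyH
    rw [rMat] at h1 h2
    rw [h1]
    exact h2.ne'
end

section
/- For every n ≥ 1, the Randić energy of the Dutch windmill graph D_4^n is RE(D_4^n) = 2 + (n − 1)·√2. -/
open scoped Classical

/-- The Dutch windmill graph `D_m^n`, obtained from `n` disjoint copies of the cycle `C_m`
by identifying one vertex from each copy into a single common vertex (the hub `none`).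
Each copy `i` is the cycle `none — (i,0) — (i,1) — ⋯ — (i,m-2) — none`. -/
def dutchWindmill (m n : ℕ) : SimpleGraph (Option (Fin n × Fin (m - 1))) :=
  SimpleGraph.fromRel fun x y =>
    match x, y with
    | none, some (_, j) => j.val = 0 ∨ j.val = m - 2
    | some (i, j), some (i', j') => i = i' ∧ j.val + 1 = j'.val
    | _, _ => False

noncomputable def dwC (n : ℕ) : ℝ := 1 / (2 * Real.sqrt n)

noncomputable def dwMat (n : ℕ) : Matrix (Option (Fin n × Fin 3)) (Option (Fin n × Fin 3)) ℝ :=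
  fun x y => match x, y with
    | none, none => 0
    | none, some (_, j) => if j = 1 then 0 else dwC n
    | some (_, j), none => if j = 1 then 0 else dwC n
    | some (i, j), some (i', j') => if i = i' then (if (j = 1 ↔ j' = 1) then 0 else 1 / 2) else 0

def dwG (n : ℕ) : SimpleGraph (Option (Fin n × Fin 3)) := dutchWindmill 4 n

theorem dw_adj_nn (n : ℕ) : ¬ (dwG n).Adj none none := by
  simp [dwG, dutchWindmill]

theorem dw_adj_ns (n : ℕ) (i : Fin n) (j : Fin 3) :
    (dwG n).Adj none (some (i, j)) ↔ ¬ j = 1 := by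
  fin_cases j <;> simp [dwG, dutchWindmill]

theorem dw_adj_sn (n : ℕ) (i : Fin n) (j : Fin 3) :
    (dwG n).Adj (some (i, j)) none ↔ ¬ j = 1 := by
  rw [SimpleGraph.adj_comm, dw_adj_ns]

theorem dw_adj_ss (n : ℕ) (i i' : Fin n) (j j' : Fin 3) :
    (dwG n).Adj (some (i, j)) (some (i', j')) ↔ i = i' ∧ ¬ (j = 1 ↔ j' = 1) := by
  fin_cases j <;> fin_cases j' <;> simp [dwG, dutchWindmill, eq_comm]

theorem dw_deg_none (n : ℕ) : ((dwG n).degree none : ℝ) = 2 * n := by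
  rw [SimpleGraph.degree_eq_sum_if_adj]
  change ∑ w : Option (Fin n × Fin 3), _ = _
  rw [Fintype.sum_option, Fintype.sum_prod_type]
  simp only [dw_adj_nn, dw_adj_ns, Fin.sum_univ_three]
  simp [Finset.sum_add_distrib]
  ring

theorem dw_deg_some (n : ℕ) (i : Fin n) (j : Fin 3) :
    ((dwG n).degree (some (i, j)) : ℝ) = 2 := by
  rw [SimpleGraph.degree_eq_sum_if_adj]
  change ∑ w : Option (Fin n × Fin 3), _ = _
  rw [Fintype.sum_option, Fintype.sum_prod_type]
  simp only [dw_adj_sn, dw_adj_ss, Fin.sum_univ_three, ite_and]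
  fin_cases j <;> simp [Finset.sum_add_distrib] <;> norm_num

theorem dw_randic (n : ℕ) : (dwG n).randicMatrix = dwMat n := by
  have h4 : Real.sqrt (2 * 2) = 2 := by
    rw [Real.sqrt_mul_self (by norm_num)]
  have h5 : Real.sqrt (2 * n * 2) = 2 * Real.sqrt n := by
    rw [show (2 * n * 2 : ℝ) = (2 * 2) * n by ring, Real.sqrt_mul (by norm_num), h4]
  have h6 : Real.sqrt (2 * (2 * n)) = 2 * Real.sqrt n := by
    rw [show (2 * (2 * n) : ℝ) = (2 * 2) * n by ring, Real.sqrt_mul (by norm_num), h4]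
  ext x y
  change (if (dwG n).Adj x y then
    1 / Real.sqrt (((dwG n).degree x : ℝ) * ((dwG n).degree y : ℝ)) else 0) = _
  rcases x with _ | ⟨i, j⟩ <;> rcases y with _ | ⟨i', j'⟩
  · rw [if_neg (dw_adj_nn n)]; rfl
  · simp only [dw_adj_ns, dw_deg_none, dw_deg_some, h5, ite_not]; rfl
  · simp only [dw_adj_sn, dw_deg_none, dw_deg_some, h6, ite_not]; rfl
  · simp only [dw_adj_ss, dw_deg_some, h4, ite_not, ite_and]; rfl

theorem dwMat_herm (n : ℕ) : (dwMat n).IsHermitian := by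
  ext x y
  rcases x with _ | ⟨i, j⟩ <;> rcases y with _ | ⟨i', j'⟩ <;>
    simp [dwMat, eq_comm, iff_comm]

theorem dwC_sq (n : ℕ) (hn : 1 ≤ n) : (n : ℝ) * dwC n ^ 2 = 1 / 4 := by
  have : (0 : ℝ) < n := by exact_mod_cast hn
  rw [dwC, div_pow, mul_pow, Real.sq_sqrt this.le]
  field_simp; norm_num

theorem dw_tr2 (n : ℕ) (hn : 1 ≤ n) : (dwMat n ^ 2).trace = n + 1 := by
  have := dwC_sq n hn
  simp only [pow_two, Matrix.trace, Matrix.diag, Matrix.mul_apply, Fintype.sum_option,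
    Fintype.sum_prod_type, Fin.sum_univ_three, dwMat]
  simp [Finset.sum_add_distrib]
  linarith

noncomputable def dwM2 (n : ℕ) : Matrix (Option (Fin n × Fin 3)) (Option (Fin n × Fin 3)) ℝ :=
  fun x y => match x, y with
    | none, none => 1 / 2
    | none, some (_, j) => if j = 1 then dwC n else 0
    | some (_, j), none => if j = 1 then dwC n else 0
    | some (i, j), some (i', j') =>
      if j = 1 then (if j' = 1 then (if i = i' then 1 / 2 else 0) else 0)
      else (if j' = 1 then 0 else (dwC n ^ 2 + if i = i' then 1 / 4 else 0))

theorem dw_sq (n : ℕ) (hn : 1 ≤ n) : dwMat n * dwMat n =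
    dwM2 n := by
  have := dwC_sq n hn
  ext x y
  rcases x with _ | ⟨i, j⟩ <;> rcases y with _ | ⟨i', j'⟩ <;>
    simp only [Matrix.mul_apply, Fintype.sum_option,
      Fintype.sum_prod_type, Fin.sum_univ_three, dwMat, dwM2]
  · simp
    linarith
  · fin_cases j' <;> simp [Finset.sum_add_distrib]
    ring
  · fin_cases j <;> simp [Finset.sum_add_distrib]
    ring
  · fin_cases j <;> fin_cases j' <;> simp [Finset.sum_add_distrib] <;> split_ifs <;> ring

theorem dw_tr4 (n : ℕ) (hn : 1 ≤ n) : (dwMat n ^ 4).trace = (n + 3) / 2 := by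
  have := dwC_sq n hn
  rw [show dwMat n ^ 4 = (dwMat n * dwMat n) * (dwMat n * dwMat n) by
    rw [← pow_two, ← pow_two, ← pow_mul], dw_sq n hn]
  simp only [Matrix.trace, Matrix.diag, Matrix.mul_apply, Fintype.sum_option,
    Fintype.sum_prod_type, Fin.sum_univ_three, dwM2]
  have h (i j : Fin n) : (dwC n ^ 2 + if i = j then (1 / 4 : ℝ) else 0) *
    (dwC n ^ 2 + if j = i then (1 / 4 : ℝ) else 0) =
    dwC n ^ 4 + if i = j then (dwC n ^ 2 / 2 + 1 / 16) else 0 := by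
    by_cases e : i = j
    · subst e; simp; ring
    · simp [e, Ne.symm e]; ring
  have d0 : ((0 : Fin 3) = 1) = False := by simp
  have d2 : ((2 : Fin 3) = 1) = False := by simp
  simp only [d0, d2, if_true, if_false, h]
  simp [Finset.sum_add_distrib]
  have h2 : (n : ℝ) * (n * dwC n ^ 4) = 1 / 16 := by
    calc _ = ((n : ℝ) * dwC n ^ 2) ^ 2 := by ring
      _ = _ := by rw [this]; norm_num
  linarith

theorem dw_eig (n : ℕ) (hn : 1 ≤ n) (v : Option (Fin n × Fin 3) → ℝ) (hv : v ≠ 0) (l : ℝ)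
    (h : (dwMat n).mulVec v = l • v) : l = 0 ∨ l ^ 2 = 1 ∨ l ^ 2 = 1 / 2 := by
  have hc := dwC_sq n hn
  by_contra! hne
  obtain ⟨h0, h1, h2⟩ := hne
  apply hv
  have e0 := congrFun h none
  have e1 (i : Fin n) (j : Fin 3) := congrFun h (some (i, j))
  simp only [Matrix.mulVec, dotProduct, Fintype.sum_option,
    Fintype.sum_prod_type, Fin.sum_univ_three, dwMat, Pi.smul_apply, smul_eq_mul] at e0 e1
  have x0 (i : Fin n) := e1 i 0
  have x1 (i : Fin n) := e1 i 1
  have x2 (i : Fin n) := e1 i 2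
  simp [Finset.sum_add_distrib] at e0 x0 x1 x2
  have z0 (i : Fin n) : v (some (i, 0)) = v (some (i, 2)) := by
    apply mul_left_cancel₀ h0
    linarith [x0 i, x2 i]
  have y0 (i : Fin n) : v (some (i, 0)) = l * v (some (i, 1)) := by
    linarith [x1 i, z0 i]
  have y2 (i : Fin n) : v (some (i, 2)) = l * v (some (i, 1)) := by
    linarith [y0 i, z0 i]
  have w (i : Fin n) : (l ^ 2 - 1 / 2) * v (some (i, 1)) = dwC n * v none := by
    have a := x0 i
    rw [y0 i] at a
    linarith
  simp only [y0, y2, ← Finset.mul_sum] at e0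
  have hs : v none = 2 * dwC n * ∑ i, v (some (i, 1)) := by
    apply mul_left_cancel₀ h0
    linarith
  have hw : (l ^ 2 - 1 / 2) * ∑ i, v (some (i, 1)) = n * (dwC n * v none) := by
    rw [Finset.mul_sum, Finset.sum_congr rfl (fun i _ => w i)]
    simp
  have hh : (l ^ 2 - 1) * v none = 0 := by
    linear_combination (l ^ 2 - 1 / 2) * hs + 2 * dwC n * hw + 2 * v none * hc
  have hN : v none = 0 := (mul_eq_zero.mp hh).resolve_left (sub_ne_zero.mpr h1)
  have h1' (i : Fin n) : v (some (i, 1)) = 0 := by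
    have a := w i
    rw [hN, mul_zero] at a
    exact (mul_eq_zero.mp a).resolve_left (sub_ne_zero.mpr h2)
  funext x
  rcases x with _ | ⟨i, j⟩
  · exact hN
  · fin_cases j
    · simpa [h1'] using y0 i
    · exact h1' i
    · simpa [h1'] using y2 i

theorem trace_pow_eq_sum_eig {m : Type*} [Fintype m] (A : Matrix m m ℝ) (hA : A.IsHermitian)
    (k : ℕ) : (A ^ k).trace = ∑ i, hA.eigenvalues i ^ k := by
  conv_lhs => rw [hA.spectral_theorem, ← map_pow, Unitary.conjStarAlgAut_apply,
    Matrix.trace_mul_comm, ← mul_assoc]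
  simp [Matrix.diagonal_pow, Matrix.trace_diagonal]

theorem energy_formula {m : Type*} [Fintype m] (A : Matrix m m ℝ) (hA : A.IsHermitian)
    (h : ∀ (v : m → ℝ), v ≠ 0 → ∀ l : ℝ, A.mulVec v = l • v → l = 0 ∨ l ^ 2 = 1 ∨ l ^ 2 = 1 / 2) :
    matrixEnergy A = (2 * Real.sqrt 2 - 1) * (A ^ 2).trace
      + (2 - 2 * Real.sqrt 2) * (A ^ 4).trace := by
  rw [matrixEnergy, dif_pos hA, trace_pow_eq_sum_eig A hA, trace_pow_eq_sum_eig A hA,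
    Finset.mul_sum, Finset.mul_sum, ← Finset.sum_add_distrib]
  refine Finset.sum_congr rfl fun i _ => ?_
  have hne : (⇑(hA.eigenvectorBasis i) : m → ℝ) ≠ 0 := by
    intro h0
    apply hA.eigenvectorBasis.orthonormal.ne_zero i
    ext j
    exact congrFun h0 j
  have := h _ hne _ (hA.mulVec_eigenvectorBasis i)
  generalize hA.eigenvalues i = l at this
  have h4 : l ^ 4 = (l ^ 2) ^ 2 := by ring
  rcases this with h | h | h
  · simp [h]
  · rw [← Real.sqrt_sq_eq_abs, h4, h]; norm_num
  · rw [← Real.sqrt_sq_eq_abs, h4, h]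
    have h2 : Real.sqrt (1 / 2) = Real.sqrt 2 / 2 := by
      rw [show (1 / 2 : ℝ) = 2 / 2 ^ 2 by norm_num, Real.sqrt_div (by norm_num),
        Real.sqrt_sq (by norm_num)]
    rw [h2]; ring

theorem randicEnergy_dutchWindmill_four (n : ℕ) (hn : 1 ≤ n) :
    (dutchWindmill 4 n).randicEnergy = 2 + ((n : ℝ) - 1) * Real.sqrt 2 := by
  have key : matrixEnergy (dwMat n) = 2 + ((n : ℝ) - 1) * Real.sqrt 2 := by
    rw [energy_formula _ (dwMat_herm n) (dw_eig n hn)]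
    have t2 := dw_tr2 n hn
    have t4 := dw_tr4 n hn
    have e2 : (n : ℝ) + 1 = n + 1 := rfl
    convert_to (2 * Real.sqrt 2 - 1) * ((n : ℝ) + 1) + (2 - 2 * Real.sqrt 2) * (((n : ℝ) + 3) / 2) = _
    · rw [← t2, ← t4]
      congr!
    · ring
  change (dwG n).randicEnergy = _
  rw [SimpleGraph.randicEnergy, dw_randic]
  exact key
end

section
/- For every n ≥ 1, the Randić energy of the Dutch windmill graph D_5^n is RE(D_5^n) = 1 + n·√5. -/
open scoped Classical

lemma adj_iff (n : ℕ) (x y) : (dutchWindmill 5 n).Adj x y ↔ match x, y with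
    | none, none => False
    | none, some (_, j) => j.val = 0 ∨ j.val = 3
    | some (_, j), none => j.val = 0 ∨ j.val = 3
    | some (i, j), some (i', j') => i = i' ∧ (j.val + 1 = j'.val ∨ j'.val+1 = j.val) := by
  rcases x with _ | ⟨i, j⟩ <;> rcases y with _ | ⟨i', j'⟩ <;> simp [dutchWindmill] <;> grind

lemma sum_five {M : Type*} [AddCommMonoid M] (f : Fin (5 - 1) → M) :
    ∑ x, f x = f ⟨0, by norm_num⟩ + f ⟨1, by norm_num⟩ + f ⟨2, by norm_num⟩ + f ⟨3, by norm_num⟩ :=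
  Fin.sum_univ_four f

lemma deg_none (n : ℕ) [Fintype ((dutchWindmill 5 n).neighborSet none)] : (dutchWindmill 5 n).degree none = 2 * n := by
  rw [← SimpleGraph.card_neighborFinset_eq_degree]
  have hf : ∀ s : Finset (Option (Fin n × Fin (5 - 1))), s.card = ∑ x, if x ∈ s then 1 else 0 := by
    intro s; simp
  rw [hf]
  simp only [SimpleGraph.mem_neighborFinset]
  simp only [adj_iff, Fintype.sum_option, Fintype.sum_prod_type, sum_five]
  simp
  ring

lemma deg_some (n : ℕ) (p) [Fintype ((dutchWindmill 5 n).neighborSet (some p))] : (dutchWindmill 5 n).degree (some p) = 2 := by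
  obtain ⟨i, j⟩ := p
  rw [← SimpleGraph.card_neighborFinset_eq_degree]
  have hf : ∀ s : Finset (Option (Fin n × Fin (5 - 1))), s.card = ∑ x, if x ∈ s then 1 else 0 := by
    intro s; simp
  rw [hf]
  simp only [SimpleGraph.mem_neighborFinset]
  simp only [adj_iff, Fintype.sum_option, Fintype.sum_prod_type, sum_five]
  change Fin 4 at j
  fin_cases j <;> simp [ite_and, Finset.sum_add_distrib]

/-- The Randić matrix of the windmill graph with a normalised index type. -/
noncomputable def windR (n : ℕ) : Matrix (Option (Fin n × Fin 4)) (Option (Fin n × Fin 4)) ℝ :=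
  (dutchWindmill 5 n).randicMatrix

/-- hub-rim entry -/
noncomputable def hubC (n : ℕ) : ℝ := 1 / Real.sqrt (2 * n * 2)

lemma hubC_sq (n : ℕ) (hn : 1 ≤ n) : (n : ℝ) * hubC n ^ 2 = 1 / 4 := by
  have : (0:ℝ) < n := by exact_mod_cast hn
  rw [hubC, div_pow, Real.sq_sqrt (by positivity)]
  field_simp
  norm_num

lemma randic_apply (n : ℕ) (x y : Option (Fin n × Fin (5 - 1))) :
    (dutchWindmill 5 n).randicMatrix x y =
      if (match x, y with
        | none, none => False
        | none, some (_, j) => j.val = 0 ∨ j.val = 3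
        | some (_, j), none => j.val = 0 ∨ j.val = 3
        | some (i, j), some (i', j') => i = i' ∧ (j.val + 1 = j'.val ∨ j'.val+1 = j.val))
      then 1 / √((x.elim (2 * n : ℝ) fun _ => 2) * (y.elim (2 * n : ℝ) fun _ => 2)) else 0 := by
  have hd : ∀ z : Option (Fin n × Fin (5 - 1)),
      ((dutchWindmill 5 n).degree z : ℝ) = z.elim (2 * n : ℝ) fun _ => 2 := by
    rintro (_ | p)
    · rw [deg_none]; simp
    · rw [deg_some]; simp
  simp only [SimpleGraph.randicMatrix, Matrix.of_apply]
  rw [← hd, ← hd]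
  simp only [adj_iff]

lemma windR_apply (n : ℕ) (x y : Option (Fin n × Fin 4)) :
    windR n x y =
      if (match x, y with
        | none, none => False
        | none, some (_, j) => j.val = 0 ∨ j.val = 3
        | some (_, j), none => j.val = 0 ∨ j.val = 3
        | some (i, j), some (i', j') => i = i' ∧ (j.val + 1 = j'.val ∨ j'.val+1 = j.val))
      then 1 / √((x.elim (2 * n : ℝ) fun _ => 2) * (y.elim (2 * n : ℝ) fun _ => 2)) else 0 :=
  randic_apply n x y

lemma R_nn (n : ℕ) : windR n none none = 0 := by
  simp [windR, SimpleGraph.randicMatrix]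
lemma R_ns (n : ℕ) (i : Fin n) (j : Fin 4) :
    windR n none (some (i, j)) = if j = 0 ∨ j = 3 then hubC n else 0 := by
  rw [windR_apply]
  simp only [hubC]
  fin_cases j <;> simp
lemma R_sn (n : ℕ) (i : Fin n) (j : Fin 4) :
    windR n (some (i, j)) none = if j = 0 ∨ j = 3 then hubC n else 0 := by
  rw [windR_apply]
  simp only [hubC]
  fin_cases j <;> simp [mul_comm]
lemma R_ss (n : ℕ) (i i' : Fin n) (j j' : Fin 4) :
    windR n (some (i, j)) (some (i', j')) =
      if i = i' then (if (j.val + 1 = j'.val ∨ j'.val+1 = j.val) then 1/2 else 0) else 0 := by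
  rw [windR_apply]
  norm_num [Real.sqrt_mul_self, ite_and]

lemma R_herm (n : ℕ) : (windR n).IsHermitian := by
  ext i j
  simp [windR, SimpleGraph.randicMatrix, SimpleGraph.adj_comm, mul_comm]

lemma trace_sq {m : Type*} [Fintype m] [DecidableEq m] {A : Matrix m m ℝ} (hA : A.IsHermitian) :
    (A * A).trace = ∑ i, hA.eigenvalues i ^ 2 := by
  have h := hA.spectral_theorem
  conv_lhs => rw [h, ← map_mul]
  rw [Unitary.conjStarAlgAut_apply, Matrix.trace_mul_cycle]
  simp [Matrix.trace, sq]

lemma R_trace (n : ℕ) (hn : 1 ≤ n) :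
    (windR n * windR n).trace = 3 * n / 2 + 1 := by
  have h := hubC_sq n hn
  simp only [Matrix.trace, Matrix.diag, Matrix.mul_apply, Fintype.sum_option]
  rw [R_nn]
  simp only [Fintype.sum_prod_type, R_ns, R_sn, R_ss]
  simp [Fin.sum_univ_four]
  linear_combination 4 * h

lemma eig_mem (n : ℕ) (hn : 1 ≤ n) (l : ℝ) (v : Option (Fin n × Fin 4) → ℝ) (hv : v ≠ 0)
    (h : (windR n).mulVec v = l • v) :
    (l - 1) * (l ^ 2 - l / 2 - 1 / 4) * (l ^ 2 + l / 2 - 1 / 4) = 0 := by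
  by_contra hne
  have hc := hubC_sq n hn
  have key : ∀ x, ∑ y, windR n x y * v y = l * v x := fun x => congrFun h x
  have h0 := key none
  simp only [Fintype.sum_option] at h0
  rw [R_nn] at h0
  simp only [Fintype.sum_prod_type, R_ns] at h0
  simp [Fin.sum_univ_four] at h0
  have hs : ∀ i : Fin n, ∀ j : Fin 4, (if j = 0 ∨ j = 3 then hubC n else 0) * v none +
     ∑ j' : Fin 4, (if (j.val + 1 = j'.val ∨ j'.val+1 = j.val) then 1/2 else 0) * v (some (i, j')) = l * v (some (i,j)) := by
    intro i j
    rw [← key (some (i, j)), Fintype.sum_option, R_sn]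
    congr 1
    simp [Fintype.sum_prod_type, R_ss]
  have e0 := fun i => hs i 0
  have e1 := fun i => hs i 1
  have e2 := fun i => hs i 2
  have e3 := fun i => hs i 3
  simp [Fin.sum_univ_four] at e0 e1 e2 e3
  clear hs key
  have hq1 : l - 1 ≠ 0 := fun h => hne (by rw [h]; ring)
  have hq2 : l ^ 2 - l / 2 - 1 / 4 ≠ 0 := fun h => hne (by rw [h]; ring)
  have hq3 : l ^ 2 + l / 2 - 1 / 4 ≠ 0 := fun h => hne (by rw [h]; ring)
  have d0 : ∀ i, v (some (i, 3)) = v (some (i, 0)) := fun i => by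
    have : (l ^ 2 + l / 2 - 1 / 4) * (v (some (i, 3)) - v (some (i, 0))) = 0 := by
      linear_combination (l + 1 / 2) * (e0 i - e3 i) + (1 / 2) * (e1 i - e2 i)
    linarith [(mul_eq_zero.1 this).resolve_left hq3]
  have d1 : ∀ i, v (some (i, 2)) = v (some (i, 1)) := fun i => by
    linear_combination 2 * (e3 i - e0 i) + 2 * l * d0 i
  have s0 : ∀ i, v (some (i, 0)) = (2 * l - 1) * v (some (i, 1)) := fun i => by
    linear_combination 2 * e1 i - d1 i
  have s1 : ∀ i, hubC n * v none = 2 * (l ^ 2 - l / 2 - 1 / 4) * v (some (i, 1)) := fun i => by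
    linear_combination e0 i + l * s0 i
  have hh : v none = 0 := by
    have t : (l ^ 2 - l / 2 - 1 / 4) * (l * v none) = (2 * l - 1) / 4 * v none := by
      rw [← h0, Finset.mul_sum]
      have : ∀ i ∈ (Finset.univ : Finset (Fin n)), (l ^ 2 - l / 2 - 1 / 4) *
          (hubC n * v (some (i, 0)) + hubC n * v (some (i, 3))) = (2 * l - 1) * hubC n ^ 2 * v none := by
        intro i _
        rw [d0, s0]
        linear_combination (-(2 * l - 1) * hubC n) * s1 i
      rw [Finset.sum_congr rfl this]
      simp
      linear_combination (2 * l - 1) * v none * hc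
    have : ((l - 1) * (l ^ 2 + l / 2 - 1 / 4)) * v none = 0 := by linear_combination t
    exact (mul_eq_zero.1 this).resolve_left (mul_ne_zero hq1 hq3)
  have v1 : ∀ i, v (some (i, 1)) = 0 := fun i => by
    have := s1 i
    rw [hh, mul_zero] at this
    exact (mul_eq_zero.1 this.symm).resolve_left (mul_ne_zero two_ne_zero hq2)
  apply hv
  funext x
  rcases x with _ | ⟨i, j⟩
  · exact hh
  · fin_cases j <;> simp [d0, d1, s0, v1]

lemma abs_eig_cases (l : ℝ) (h : (l - 1) * (l ^ 2 - l / 2 - 1 / 4) * (l ^ 2 + l / 2 - 1 / 4) = 0) :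
    |l| = 1 ∨ |l| = (√5 + 1) / 4 ∨ |l| = (√5 - 1) / 4 := by
  have h5 : √5 ^ 2 = 5 := Real.sq_sqrt (by norm_num)
  have h1 : 1 < √5 := by rw [Real.lt_sqrt] <;> norm_num
  have : (l - 1) * ((l - (√5 + 1) / 4) * (l + (√5 - 1) / 4)) * ((l + (√5 + 1) / 4) * (l - (√5 - 1) / 4)) = 0 := by
    rw [← h]; congr 1
    · congr 1; linear_combination (-1/16) * h5
    · linear_combination (-1/16) * h5
  simp only [mul_eq_zero] at this
  rcases this with (h | h | h) | h | h
  · left; rw [sub_eq_zero.1 h]; simp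
  · right; left; rw [sub_eq_zero.1 h]; exact abs_of_pos (by linarith)
  · right; right; rw [eq_neg_of_add_eq_zero_left h, abs_neg]; exact abs_of_pos (by linarith)
  · right; left; rw [eq_neg_of_add_eq_zero_left h, abs_neg]; exact abs_of_pos (by linarith)
  · right; right; rw [sub_eq_zero.1 h]; exact abs_of_pos (by linarith)

lemma count_aux {m : Type*} [Fintype m] (f : m → ℝ)
    (h : ∀ i, |f i| = 1 ∨ |f i| = (√5 + 1) / 4 ∨ |f i| = (√5 - 1) / 4) :
    ∃ a b c : ℕ, a + b + c = Fintype.card m ∧ ∑ i, |f i| = a + b * ((√5 + 1) / 4) + c * ((√5 - 1) / 4) ∧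
      ∑ i, f i ^ 2 = a + b * ((√5 + 1) / 4) ^ 2 + c * ((√5 - 1) / 4) ^ 2 := by
  have : ∀ s : Finset m, ∃ a b c : ℕ, a + b + c = s.card ∧ ∑ i ∈ s, |f i| = a + b * ((√5 + 1) / 4) + c * ((√5 - 1) / 4) ∧
      ∑ i ∈ s, f i ^ 2 = a + b * ((√5 + 1) / 4) ^ 2 + c * ((√5 - 1) / 4) ^ 2 := by
    intro s
    induction s using Finset.induction_on with
    | empty => exact ⟨0, 0, 0, by simp⟩
    | insert x s hx ih =>
      obtain ⟨a, b, c, h1, h2, h3⟩ := ih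
      simp only [Finset.sum_insert hx, Finset.card_insert_of_notMem hx, h2, h3, ← h1, ← sq_abs (f x)]
      rcases h x with e | e | e <;> rw [e]
      · exact ⟨a + 1, b, c, by omega, by push_cast; ring, by push_cast; ring⟩
      · exact ⟨a, b + 1, c, by omega, by push_cast; ring, by push_cast; ring⟩
      · exact ⟨a, b, c + 1, by omega, by push_cast; ring, by push_cast; ring⟩
  exact this Finset.univ

theorem randicEnergy_dutchWindmill_five (n : ℕ) (hn : 1 ≤ n) :
    (dutchWindmill 5 n).randicEnergy = 1 + (n : ℝ) * Real.sqrt 5 := by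
  have hA := R_herm n
  have hE : (dutchWindmill 5 n).randicEnergy = ∑ i, |hA.eigenvalues i| := dif_pos hA
  rw [hE]
  obtain ⟨a, b, c, h1, h2, h3⟩ := count_aux hA.eigenvalues (fun i => abs_eig_cases _
    (eig_mem n hn _ (hA.eigenvectorBasis i).ofLp (by
      intro h0
      have := hA.eigenvectorBasis.orthonormal.ne_zero i
      exact this (by ext j; exact congrFun h0 j)) (hA.mulVec_eigenvectorBasis i)))
  rw [h2]
  rw [← trace_sq, R_trace n hn] at h3
  have h5 : √5 ^ 2 = 5 := Real.sq_sqrt (by norm_num)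
  have h1 : a + b + c = 4 * n + 1 := by rw [h1]; simp; ring
  have hr : (a + b + c : ℝ) = 4 * n + 1 := by exact_mod_cast h1
  have hbc : b = c := by
    by_contra hne
    have hd : ((b : ℝ) - c) ≠ 0 := by rw [sub_ne_zero]; exact_mod_cast hne
    have : √5 = (12 * n + 8 - 8 * a - 3 * b - 3 * c) / (b - c) := by
      rw [eq_div_iff hd]; linear_combination (-8) * h3 - (b + c) / 2 * h5
    have irr : Irrational √5 := by simpa using (Nat.Prime.irrational_sqrt (p := 5) (by norm_num))
    exact irr ⟨(12 * n + 8 - 8 * a - 3 * b - 3 * c) / (b - c), by rw [this]; push_cast; rfl⟩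
  subst hbc
  have hb : (b : ℝ) = 2 * n := by nlinarith
  have ha : (a : ℝ) = 1 := by linarith
  rw [ha, hb]; ring
end

section
/- The set of Randić energies of finite simple graphs is dense in the interval [2, 3): for every real number x with 2 ≤ x < 3 and every ε > 0, there exists a finite simple graph G with |RE(G) − x| < ε. -/
open scoped Classical

theorem energy_of_charpoly {V : Type} [Fintype V] (A : Matrix V V ℝ) (hA : A.IsHermitian) :
    matrixEnergy A = (A.charpoly.roots.map (fun x => |x|)).sum := by
  unfold matrixEnergy
  rw [dif_pos hA, hA.roots_charpoly_eq_eigenvalues]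
  simp

theorem charpoly_four (a b c : ℝ) (a' b' c' : ℝ) :
    (!![0, a, 0, 0; a', 0, b, 0; 0, b', 0, c; 0, 0, c', 0] : Matrix (Fin 4) (Fin 4) ℝ).charpoly
      = Polynomial.X ^ 4 - Polynomial.C (a * a' + b * b' + c * c') * Polynomial.X ^ 2
        + Polynomial.C (a * a' * (c * c')) := by
  simp [Matrix.charpoly, Matrix.charmatrix, Matrix.det_succ_row_zero, Fin.sum_univ_succ, Fin.succAbove,
    Matrix.diagonal]
  ring

def pathAdj (i j : Fin 4) : Prop := i.val + 1 = j.val ∨ j.val + 1 = i.val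

def blow (m n : ℕ) : SimpleGraph (Σ i : Fin 4, Fin ((![m, n, n, m] : Fin 4 → ℕ) i)) where
  Adj x y := pathAdj x.1 y.1
  symm := ⟨fun x y h => h.symm⟩
  loopless := ⟨fun x h => by unfold pathAdj at h; omega⟩

noncomputable def degs (m n : ℕ) : Fin 4 → ℕ := ![n, m + n, m + n, n]

theorem blow_degree (m n : ℕ) (v) : (blow m n).degree v = degs m n v.1 := by
  rw [← SimpleGraph.card_neighborFinset_eq_degree, SimpleGraph.neighborFinset_eq_filter,
    Finset.card_filter, Fintype.sum_sigma]
  obtain ⟨i, v⟩ := v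
  fin_cases i <;> simp [blow, pathAdj, degs, Fin.sum_univ_succ, add_comm]

noncomputable def small (m n : ℕ) : Matrix (Fin 4) (Fin 4) ℝ :=
  Matrix.of fun i j => if pathAdj i j then 1 / Real.sqrt ((degs m n i : ℝ) * (degs m n j : ℝ)) else 0

noncomputable def ind (m n : ℕ) :
    Matrix (Σ i : Fin 4, Fin ((![m, n, n, m] : Fin 4 → ℕ) i)) (Fin 4) ℝ :=
  Matrix.of fun v i => if v.1 = i then 1 else 0

theorem blow_factor (m n : ℕ) :
    (blow m n).randicMatrix = ind m n * (small m n * (ind m n).transpose) := by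
  ext x y
  have h : ∀ B : Matrix (Fin 4) (Σ i : Fin 4, Fin ((![m, n, n, m] : Fin 4 → ℕ) i)) ℝ,
      (ind m n * B) x y = B x.1 y := by
    intro B
    simp [Matrix.mul_apply, ind]
  rw [h]
  simp only [SimpleGraph.randicMatrix, Matrix.mul_apply, blow_degree, ind, small, Matrix.of_apply,
    Matrix.transpose_apply, mul_ite, mul_one, mul_zero,
    Finset.sum_ite_eq, Finset.mem_univ, if_true]
  rfl

theorem ind_sq (m n : ℕ) :
    (ind m n).transpose * ind m n = Matrix.diagonal ![(m : ℝ), n, n, m] := by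
  ext i j
  rw [Matrix.mul_apply, Fintype.sum_sigma]
  fin_cases i <;> fin_cases j <;> simp [ind, Matrix.diagonal] <;> first | rfl | exact Finset.card_fin _

theorem blow_energy (m n : ℕ) (hm : 0 < m) (hn : 0 < n) :
    (blow m n).randicEnergy = 2 + 2 * ((m : ℝ) / (m + n)) := by
  have hm' : (0 : ℝ) < m := by exact_mod_cast hm
  have hn' : (0 : ℝ) < n := by exact_mod_cast hn
  set s : ℝ := (m : ℝ) / (m + n) with hs
  have hs0 : 0 < s := by positivity
  have hH : (blow m n).randicMatrix.IsHermitian := by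
    ext x y
    simp [SimpleGraph.randicMatrix, SimpleGraph.adj_comm, mul_comm]
  unfold SimpleGraph.randicEnergy
  rw [energy_of_charpoly _ hH]
  have h1 := Matrix.charpoly_mul_comm' (ind m n) (small m n * (ind m n).transpose)
  rw [← blow_factor, Matrix.mul_assoc, ind_sq] at h1
  set r : ℝ := Real.sqrt ((n : ℝ) * (m + n)) with hr
  have hr2 : r * r = n * (m + n) := Real.mul_self_sqrt (by positivity)
  have hr0 : 0 < r := Real.sqrt_pos.2 (by positivity)
  have hq : Real.sqrt ((m : ℝ) + n) ^ 2 = m + n := Real.sq_sqrt (by positivity)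
  have hr1 : r = Real.sqrt n * Real.sqrt ((m : ℝ) + n) := Real.sqrt_mul (by positivity) _
  have h2 : small m n * Matrix.diagonal ![(m : ℝ), n, n, m] =
      !![0, n / r, 0, 0; m / r, 0, n / (m + n), 0; 0, n / (m + n), 0, m / r; 0, 0, n / r, 0] := by
    ext i j
    rw [Matrix.mul_diagonal]
    fin_cases i <;> fin_cases j <;>
      simp [small, pathAdj, degs] <;> field_simp <;> linarith [hr1, hq, mul_comm (Real.sqrt n) (Real.sqrt ((m : ℝ) + n))]
  have e1 : (n : ℝ) / r * (m / r) = s := by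
    rw [div_mul_div_comm, hr2, hs]; field_simp
  have e2 : (n : ℝ) / (m + n) = 1 - s := by
    rw [hs]; field_simp; ring
  have h3 : (small m n * Matrix.diagonal ![(m : ℝ), n, n, m]).charpoly =
      (({1, -1, s, -s} : Multiset ℝ).map (fun a => Polynomial.X - Polynomial.C a)).prod := by
    rw [h2, charpoly_four, mul_comm ((m : ℝ) / r), e1, e2]
    simp
    ring
  have h4 : (small m n * Matrix.diagonal ![(m : ℝ), n, n, m]).charpoly.roots = {1, -1, s, -s} := by
    rw [h3, Polynomial.roots_multiset_prod_X_sub_C]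
  have hX : ∀ k : ℕ, (Polynomial.X ^ k : Polynomial ℝ) ≠ 0 := fun k => pow_ne_zero _ Polynomial.X_ne_zero
  have h5 := congrArg (fun p : Polynomial ℝ => (p.roots.map (fun x => |x|)).sum) h1
  rw [Polynomial.roots_mul (mul_ne_zero (hX _) (Matrix.charpoly_monic _).ne_zero),
    Polynomial.roots_mul (mul_ne_zero (hX _) (Matrix.charpoly_monic _).ne_zero), h4] at h5
  simp [abs_of_pos hs0, Multiset.map_nsmul, Multiset.sum_nsmul] at h5
  have h6 : 2 + 2 * s = 1 + (1 + (s + s)) := by ring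
  rw [h6, ← h5]
  congr!

theorem randicEnergy_dense_Icc :
    ∀ x : ℝ, 2 ≤ x → x < 3 → ∀ ε : ℝ, 0 < ε →
      ∃ (V : Type) (inst : Fintype V) (G : SimpleGraph V),
        |@SimpleGraph.randicEnergy V inst G - x| < ε := by
  intro x hx hx3 ε hε
  obtain ⟨q, hq1, hq2⟩ := exists_rat_btwn
    (show (x - 2) / 2 < min ((x - 2) / 2 + ε / 2) 1 from lt_min (by linarith) (by linarith))
  obtain ⟨hq2, hq3⟩ := lt_min_iff.1 hq2
  have hq0 : 0 < q := by
    have : (0 : ℝ) < q := by linarith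
    exact_mod_cast this
  have hq1' : q < 1 := by exact_mod_cast hq3
  obtain ⟨m, hm⟩ := Int.eq_ofNat_of_zero_le (Rat.num_pos.2 hq0).le
  have hmpos : 0 < m := by have := Rat.num_pos.2 hq0; omega
  have hlt : m < q.den := by
    have h := Rat.lt_iff q 1
    have := h.1 hq1'
    simp [hm] at this
    omega
  obtain ⟨n, hn⟩ := Nat.exists_eq_add_of_lt hlt
  refine ⟨_, inferInstance, blow m (n + 1), ?_⟩
  rw [blow_energy m (n + 1) hmpos (by omega)]
  have hqe : (m : ℝ) / (m + (n + 1 : ℕ)) = q := by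
    rw [Rat.cast_def, hm, hn]
    push_cast
    ring
  rw [hqe, abs_lt]
  constructor <;> linarith
end
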